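/- arXiv:1801.01050 — 4 statements merged into one kernel-verified Lean document; each statement's English description precedes it below -/
import Mathlib

section
/- Let 𝒴 be a finite set, 𝒳 and 𝒵 arbitrary measurable spaces, and μ_{ZYX} a joint law of (Z,Y,X). For some n ∈ ℕ, let f : 𝒳^n → M be a measurable function with M a finite set. Then for any ε > 0 there exists a probability measure μ_{ZYXU}, extending μ_{ZYX}, with 𝒰 finite, such that the Markov chain (Z,Y) ⊸ X ⊸ U holds, I(X;U) ≤ (1/n)·log|M|, and I(Y;U) ≥ (1/n)·I(Y^n; f(X^n)) − ε, where (Y^n,X^n) are n i.i.d. copies of (Y,X). -/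
open MeasureTheory Real
open scoped ENNReal

noncomputable section

namespace IB

/-- Real-valued indicator function of a set. -/
def ind {Ω : Type*} (s : Set Ω) : Ω → ℝ := Set.indicator s (fun _ => (1 : ℝ))

/-- Shannon entropy of a random variable with finite alphabet. -/
noncomputable def ent {Ω α : Type*} [MeasurableSpace Ω] [Fintype α]
    (μ : Measure Ω) (A : Ω → α) : ℝ :=
  ∑ a : α, Real.negMulLog ((μ (A ⁻¹' {a})).toReal)

/-- Discrete mutual information `I(A;B) = H(A) + H(B) - H(A,B)` for finite alphabets. -/
noncomputable def miFin {Ω α β : Type*} [MeasurableSpace Ω] [Fintype α] [Fintype β]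
    (μ : Measure Ω) (A : Ω → α) (B : Ω → β) : ℝ :=
  ent μ A + ent μ B - ent μ (fun ω => (A ω, B ω))

/-- Mutual information of random variables with arbitrary alphabets: the supremum of the
discrete mutual information over all measurable finite-range quantizations. -/
noncomputable def miGen {Ω α β : Type*} [MeasurableSpace Ω] [MeasurableSpace α]
    [MeasurableSpace β] (μ : Measure Ω) (A : Ω → α) (B : Ω → β) : ℝ≥0∞ :=
  ⨆ (k : ℕ) (l : ℕ) (f : α → Fin (k + 1)) (g : β → Fin (l + 1))
    (_ : Measurable f) (_ : Measurable g),
      ENNReal.ofReal (miFin μ (f ∘ A) (g ∘ B))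

/-- The Markov chain `A ⊸ B ⊸ C`: conditional independence of `A` and `C` given `σ(B)`,
expressed via conditional expectations of indicator functions. -/
def Markov {Ω α β γ : Type*} [MeasurableSpace Ω] [MeasurableSpace α] [MeasurableSpace β]
    [MeasurableSpace γ] (μ : Measure Ω) (A : Ω → α) (B : Ω → β) (C : Ω → γ) : Prop :=
  ∀ E F, MeasurableSet E → MeasurableSet F →
    μ[ind (A ⁻¹' E ∩ C ⁻¹' F) | MeasurableSpace.comap B inferInstance]
      =ᵐ[μ]
    fun ω => (μ[ind (A ⁻¹' E) | MeasurableSpace.comap B inferInstance]) ω *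
             (μ[ind (C ⁻¹' F) | MeasurableSpace.comap B inferInstance]) ω

section FiniteEntropy

variable {Ω α β γ : Type*}

/-- All fibres of `A` are measurable. -/
def FibM [MeasurableSpace Ω] (A : Ω → α) : Prop := ∀ a, MeasurableSet (A ⁻¹' {a})

lemma FibM.of_measurable [MeasurableSpace Ω] [MeasurableSpace α] [MeasurableSingletonClass α]
    {A : Ω → α} (hA : Measurable A) : FibM A := fun a => hA (measurableSet_singleton a)

lemma FibM.preimage [MeasurableSpace Ω] [Finite α] {A : Ω → α} (hA : FibM A) (s : Set α) :
    MeasurableSet (A ⁻¹' s) := by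
  rw [← Set.biUnion_preimage_singleton]
  exact MeasurableSet.biUnion s.to_countable fun a _ => hA a

lemma FibM.comp [MeasurableSpace Ω] [Finite α] {A : Ω → α} (hA : FibM A) (g : α → β) :
    FibM (fun ω => g (A ω)) := fun b => hA.preimage (g ⁻¹' {b})

lemma FibM.prodMk [MeasurableSpace Ω] {A : Ω → α} {B : Ω → β} (hA : FibM A) (hB : FibM B) :
    FibM (fun ω => (A ω, B ω)) := fun p => by
  convert (hA p.1).inter (hB p.2) using 1
  ext ω
  simp [Prod.ext_iff]

lemma FibM.pi [MeasurableSpace Ω] {ι : Type*} [Finite ι] {A : ι → Ω → α}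
    (hA : ∀ i, FibM (A i)) : FibM (fun ω i => A i ω) := fun v => by
  convert MeasurableSet.iInter fun i => hA i (v i) using 1
  ext ω
  simp [funext_iff]

variable [MeasurableSpace Ω] [Fintype β] (μ : Measure Ω)

lemma measureReal_comp_fiber [IsFiniteMeasure μ] {B : Ω → β} (hB : FibM B) [DecidableEq α]
    (g : β → α) (a : α) :
    μ.real ((fun ω => g (B ω)) ⁻¹' {a}) = ∑ b with g b = a, μ.real (B ⁻¹' {b}) := by
  rw [← measureReal_biUnion_finset]
  · congr 1
    ext ω
    simp
  · intro b _ c _ hbc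
    exact Disjoint.preimage _ (by simpa using hbc)
  · exact fun b _ => hB b

variable [Fintype α] [Fintype γ]

lemma sum_measureReal_fiber [IsProbabilityMeasure μ] {A : Ω → α} (hA : FibM A) :
    ∑ a, μ.real (A ⁻¹' {a}) = 1 := by
  have h := measureReal_comp_fiber μ hA (fun _ => ()) ()
  have h2 : (fun _ : Ω => ()) ⁻¹' {()} = Set.univ := by ext; simp
  rw [h2] at h
  simpa using h.symm

lemma ent_comp_le [IsProbabilityMeasure μ] {B : Ω → β} (hB : FibM B) (g : β → α) :
    ent μ (fun ω => g (B ω)) ≤ ent μ B := by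
  classical
  have h : ent μ B = ∑ a, ∑ b with g b = a, negMulLog (μ.real (B ⁻¹' {b})) := by
    exact (Finset.sum_fiberwise Finset.univ g fun b => negMulLog (μ.real (B ⁻¹' {b}))).symm
  rw [h]
  refine Finset.sum_le_sum fun a _ => ?_
  change negMulLog (μ.real _) ≤ _
  rw [measureReal_comp_fiber μ hB, negMulLog, neg_mul, Finset.sum_mul, ← Finset.sum_neg_distrib]
  refine Finset.sum_le_sum fun b hb => ?_
  rw [negMulLog, neg_mul]
  rcases (measureReal_nonneg (μ := μ) (s := B ⁻¹' {b})).eq_or_lt with h0 | h0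
  · simp [← h0]
  · gcongr
    exact Finset.single_le_sum (f := fun b => μ.real (B ⁻¹' {b}))
      (fun _ _ => measureReal_nonneg) hb

lemma ent_congr [IsProbabilityMeasure μ] {A : Ω → α} {B : Ω → β} (hA : FibM A) (hB : FibM B)
    (g : β → α) (h : α → β) (hg : ∀ ω, A ω = g (B ω)) (hh : ∀ ω, B ω = h (A ω)) :
    ent μ A = ent μ B := by
  have e1 : A = fun ω => g (B ω) := funext hg
  have e2 : B = fun ω => h (A ω) := funext hh
  apply le_antisymm
  · conv_lhs => rw [e1]
    exact ent_comp_le μ hB g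
  · conv_lhs => rw [e2]
    exact ent_comp_le μ hA h

lemma mul_log_div_le {p x y z : ℝ} (hp : 0 ≤ p) (hx : p ≤ x) (hy : p ≤ y) (hz : p ≤ z) :
    p * log x + p * log y - p * log p - p * log z ≤ x * y / z - p := by
  rcases hp.eq_or_lt with rfl | h
  · simp; positivity
  · have hx' := h.trans_le hx
    have hy' := h.trans_le hy
    have hz' := h.trans_le hz
    have h1 := Real.log_le_sub_one_of_pos (x := x * y / (p * z)) (by positivity)
    rw [Real.log_div (by positivity) (by positivity), Real.log_mul hx'.ne' hy'.ne',
      Real.log_mul h.ne' hz'.ne'] at h1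
    have h2 := mul_le_mul_of_nonneg_left h1 hp
    have h3 : p * (x * y / (p * z) - 1) = x * y / z - p := by field_simp
    linarith

/-- Submodularity of Shannon entropy. -/
lemma ent_submod [IsProbabilityMeasure μ] {A : Ω → α} {B : Ω → β} {C : Ω → γ}
    (hA : FibM A) (hB : FibM B) (hC : FibM C) :
    ent μ (fun ω => (A ω, B ω, C ω)) + ent μ C ≤
      ent μ (fun ω => (A ω, C ω)) + ent μ (fun ω => (B ω, C ω)) := by
  classical
  have hABC : FibM (fun ω => (A ω, B ω, C ω)) := hA.prodMk (hB.prodMk hC)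
  set p : α → β → γ → ℝ := fun a b c => μ.real ((fun ω => (A ω, B ω, C ω)) ⁻¹' {(a, b, c)})
    with hp
  have hp0 : ∀ a b c, 0 ≤ p a b c := fun _ _ _ => measureReal_nonneg
  have hAC : ∀ a c, μ.real ((fun ω => (A ω, C ω)) ⁻¹' {(a, c)}) = ∑ b, p a b c := by
    intro a c
    rw [measureReal_comp_fiber μ hABC (fun t => (t.1, t.2.2)), Finset.sum_filter,
      Fintype.sum_prod_type]
    simp_rw [Fintype.sum_prod_type]
    rw [Finset.sum_eq_single a (by simp +contextual) (by simp)]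
    simp [hp]
  have hBC : ∀ b c, μ.real ((fun ω => (B ω, C ω)) ⁻¹' {(b, c)}) = ∑ a, p a b c := by
    intro b c
    rw [measureReal_comp_fiber μ hABC (fun t => (t.2.1, t.2.2)), Finset.sum_filter,
      Fintype.sum_prod_type]
    refine Finset.sum_congr rfl fun a _ => ?_
    rw [Finset.sum_eq_single (b, c) (by simp +contextual [Prod.ext_iff]) (by simp)]
    simp [hp]
  have hCC : ∀ c, μ.real (C ⁻¹' {c}) = ∑ a, ∑ b, p a b c := by
    intro c
    rw [measureReal_comp_fiber μ hABC (fun t => t.2.2), Finset.sum_filter,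
      Fintype.sum_prod_type]
    simp_rw [Fintype.sum_prod_type]
    simp [hp]
  have e1 : ent μ (fun ω => (A ω, B ω, C ω)) = ∑ c, ∑ a, ∑ b, -(p a b c * log (p a b c)) := by
    simp only [ent, Fintype.sum_prod_type]
    rw [Finset.sum_comm_cycle]
    refine Finset.sum_congr rfl fun c _ => Finset.sum_congr rfl fun a _ =>
      Finset.sum_congr rfl fun b _ => ?_
    rw [negMulLog, neg_mul]
    rfl
  have e2 : ent μ C = ∑ c, ∑ a, ∑ b, -(p a b c * log (∑ a, ∑ b, p a b c)) := by
    refine Finset.sum_congr rfl fun c _ => ?_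
    change negMulLog (μ.real _) = _
    rw [hCC, negMulLog]
    simp_rw [← neg_mul, ← Finset.sum_mul, Finset.sum_neg_distrib]
  have e3 : ent μ (fun ω => (A ω, C ω)) = ∑ c, ∑ a, ∑ b, -(p a b c * log (∑ b, p a b c)) := by
    simp only [ent, Fintype.sum_prod_type]
    rw [Finset.sum_comm]
    refine Finset.sum_congr rfl fun c _ => Finset.sum_congr rfl fun a _ => ?_
    change negMulLog (μ.real _) = _
    rw [hAC, negMulLog]
    simp_rw [← neg_mul, ← Finset.sum_mul, Finset.sum_neg_distrib]
  have e4 : ent μ (fun ω => (B ω, C ω)) = ∑ c, ∑ a, ∑ b, -(p a b c * log (∑ a, p a b c)) := by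
    simp only [ent, Fintype.sum_prod_type]
    rw [Finset.sum_comm]
    refine Finset.sum_congr rfl fun c _ => ?_
    rw [Finset.sum_comm]
    refine Finset.sum_congr rfl fun b _ => ?_
    change negMulLog (μ.real _) = _
    rw [hBC, negMulLog]
    simp_rw [← neg_mul, ← Finset.sum_mul, Finset.sum_neg_distrib]
  rw [e1, e2, e3, e4, ← sub_nonneg]
  simp only [← Finset.sum_add_distrib, ← Finset.sum_sub_distrib]
  refine Finset.sum_nonneg fun c _ => ?_
  have key : ∑ a, ∑ b, ((∑ b, p a b c) * (∑ a, p a b c) / (∑ a, ∑ b, p a b c) - p a b c) = 0 := by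
    simp only [Finset.sum_sub_distrib, ← Finset.sum_div, ← Finset.mul_sum, ← Finset.sum_mul]
    rw [Finset.sum_comm (f := fun b a => p a b c), mul_self_div_self, sub_self]
  rw [← neg_nonpos, ← key]
  simp only [← Finset.sum_neg_distrib]
  refine Finset.sum_le_sum fun a _ => Finset.sum_le_sum fun b _ => ?_
  have h1 : p a b c ≤ ∑ b, p a b c :=
    Finset.single_le_sum (f := fun b => p a b c) (fun _ _ => hp0 _ _ _) (Finset.mem_univ b)
  have h2 : p a b c ≤ ∑ a, p a b c :=
    Finset.single_le_sum (f := fun a => p a b c) (fun _ _ => hp0 _ _ _) (Finset.mem_univ a)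
  have h3 : ∑ b, p a b c ≤ ∑ a, ∑ b, p a b c :=
    Finset.single_le_sum (f := fun a => ∑ b, p a b c)
      (fun _ _ => Finset.sum_nonneg fun _ _ => hp0 _ _ _) (Finset.mem_univ a)
  have := mul_log_div_le (hp0 a b c) h1 h2 (h1.trans h3)
  linarith

lemma miFin_comm [IsProbabilityMeasure μ] {A : Ω → α} {B : Ω → β} (hA : FibM A) (hB : FibM B) :
    miFin μ A B = miFin μ B A := by
  have := ent_congr μ (hA.prodMk hB) (hB.prodMk hA) Prod.swap Prod.swap
    (fun _ => rfl) (fun _ => rfl)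
  simp only [miFin, this]
  ring

lemma miFin_comp_right_le [IsProbabilityMeasure μ] {A : Ω → α} {B : Ω → β} (hA : FibM A)
    (hB : FibM B) (h : β → γ) : miFin μ A (fun ω => h (B ω)) ≤ miFin μ A B := by
  have h1 := ent_submod μ hA hB (hB.comp h)
  have h2 := ent_congr μ (hB.prodMk (hB.comp h)) hB (fun b => (b, h b)) Prod.fst
    (fun _ => rfl) (fun _ => rfl)
  have h3 := ent_congr μ (hA.prodMk (hB.prodMk (hB.comp h))) (hA.prodMk hB)
    (fun p => (p.1, p.2, h p.2)) (fun p => (p.1, p.2.1)) (fun _ => rfl) (fun _ => rfl)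
  simp only [miFin]
  linarith

lemma miFin_comp_left_le [IsProbabilityMeasure μ] {A : Ω → α} {B : Ω → β} (hA : FibM A)
    (hB : FibM B) (h : α → γ) : miFin μ (fun ω => h (A ω)) B ≤ miFin μ A B := by
  rw [miFin_comm μ (hA.comp h) hB, miFin_comm μ hA hB]
  exact miFin_comp_right_le μ hB hA h

/-- The data processing inequality. -/
lemma miFin_le_of_factor [IsProbabilityMeasure μ] {α' β' : Type*} [Fintype α'] [Fintype β']
    {A : Ω → α} {B : Ω → β} {A' : Ω → α'} {B' : Ω → β'} (hA : FibM A) (hB : FibM B)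
    (g : α → α') (h : β → β') (hg : ∀ ω, A' ω = g (A ω)) (hh : ∀ ω, B' ω = h (B ω)) :
    miFin μ A' B' ≤ miFin μ A B := by
  rw [funext hg, funext hh]
  exact (miFin_comp_left_le μ hA (hB.comp h) g).trans (miFin_comp_right_le μ hA hB h)

lemma miFin_le_ent [IsProbabilityMeasure μ] {A : Ω → α} {B : Ω → β} (hA : FibM A)
    (hB : FibM B) : miFin μ A B ≤ ent μ B := by
  have := ent_comp_le μ (hA.prodMk hB) Prod.fst
  simp only [miFin]
  linarith

lemma ent_le_log_card [IsProbabilityMeasure μ] {A : Ω → α} (hA : FibM A) :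
    ent μ A ≤ log (Fintype.card α) := by
  have hne : Nonempty α := by
    obtain ⟨ω⟩ := nonempty_of_isProbabilityMeasure μ
    exact ⟨A ω⟩
  have hc : (0 : ℝ) < Fintype.card α := by exact_mod_cast Fintype.card_pos
  have hs := sum_measureReal_fiber μ hA
  have h := concaveOn_negMulLog.le_map_sum (t := Finset.univ)
    (w := fun _ : α => (Fintype.card α : ℝ)⁻¹) (p := fun a => μ.real (A ⁻¹' {a}))
    (fun _ _ => by positivity) (by simp [hc.ne']) (fun _ _ => measureReal_nonneg)
  simp only [smul_eq_mul, ← Finset.mul_sum, hs] at h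
  simp only [mul_one, negMulLog, Real.log_inv] at h
  have h' : (Fintype.card α : ℝ)⁻¹ * ent μ A ≤ (Fintype.card α : ℝ)⁻¹ * log (Fintype.card α) := by
    simp only [ent, negMulLog]
    refine h.trans_eq (by ring)
  exact le_of_mul_le_mul_left h' (by positivity)

lemma negMulLog_prod {ι : Type*} [DecidableEq ι] (s : Finset ι) (p : ι → ℝ) :
    negMulLog (∏ i ∈ s, p i) = ∑ i ∈ s, ∏ j ∈ s, if j = i then negMulLog (p j) else p j := by
  induction s using Finset.induction_on with
  | empty => simp
  | insert a s ha ih =>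
    have h1 : ∏ j ∈ s, (if j = a then negMulLog (p j) else p j) = ∏ j ∈ s, p j :=
      Finset.prod_congr rfl fun j hj => if_neg (by rintro rfl; exact ha hj)
    rw [Finset.prod_insert ha, negMulLog_mul, ih, Finset.sum_insert ha, Finset.prod_insert ha,
      if_pos rfl, Finset.mul_sum, mul_comm (negMulLog _), h1]
    congr 1
    refine Finset.sum_congr rfl fun i hi => ?_
    rw [Finset.prod_insert ha, if_neg (by rintro rfl; exact ha hi)]

section Product

variable {S : Type*} [MeasurableSpace S] (P : Measure S) [IsProbabilityMeasure P] {n : ℕ}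

lemma measureReal_pi_eval (i : Fin n) {s : Set S} (hs : MeasurableSet s) :
    (Measure.pi fun _ : Fin n => P).real ((fun ω => ω i) ⁻¹' s) = P.real s :=
  (measurePreserving_eval (fun _ : Fin n => P) i).measureReal_preimage hs.nullMeasurableSet

/-- The entropy of an i.i.d. vector is the sum of the entropies of its entries. -/
lemma ent_pi {φ : S → α} (hφ : FibM φ) :
    ent (Measure.pi fun _ : Fin n => P) (fun ω i => φ (ω i)) =
      ∑ i, ent (Measure.pi fun _ : Fin n => P) (fun ω => φ (ω i)) := by
  classical
  have h1 : ∀ v : Fin n → α, (Measure.pi fun _ : Fin n => P).real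
      ((fun ω i => φ (ω i)) ⁻¹' {v}) = ∏ i, P.real (φ ⁻¹' {v i}) := by
    intro v
    have : (fun (ω : Fin n → S) i => φ (ω i)) ⁻¹' {v} =
        Set.univ.pi fun i => φ ⁻¹' {v i} := by
      ext ω; simp [funext_iff]
    rw [this, measureReal_def, Measure.pi_pi, ENNReal.toReal_prod]
    rfl
  have h2 : ∀ i : Fin n, ent (Measure.pi fun _ : Fin n => P) (fun ω => φ (ω i)) =
      ∑ a, negMulLog (P.real (φ ⁻¹' {a})) := by
    intro i
    refine Finset.sum_congr rfl fun a _ => ?_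
    rw [← measureReal_pi_eval P i (hφ a)]
    rfl
  have h3 : ent (Measure.pi fun _ : Fin n => P) (fun ω i => φ (ω i)) =
      ∑ v : Fin n → α, negMulLog (∏ i, P.real (φ ⁻¹' {v i})) :=
    Finset.sum_congr rfl fun v _ => by rw [← h1]; rfl
  rw [h3]
  simp_rw [negMulLog_prod, h2]
  rw [Finset.sum_comm]
  refine Finset.sum_congr rfl fun i _ => ?_
  rw [← Fintype.prod_sum fun j a =>
    if j = i then negMulLog (P.real (φ ⁻¹' {a})) else P.real (φ ⁻¹' {a}),
    Finset.prod_eq_single i]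
  · simp
  · intro j _ hj
    simp [hj, sum_measureReal_fiber P hφ]
  · simp

end Product

/-- Replace the entries of `v` from index `i` on by the constant `a₀`. -/
def mask {n : ℕ} (a₀ : α) (i : ℕ) (v : Fin n → α) : Fin n → α :=
  fun j => if (j : ℕ) < i then v j else a₀

/-- The chain rule for mutual information with a vector of entropy-additive entries. -/
lemma sum_miFin_mask [IsProbabilityMeasure μ] {n : ℕ} (a₀ : α) {A : Fin n → Ω → α} {W : Ω → γ}
    (hA : ∀ i, FibM (A i)) (hW : FibM W)
    (hadd : ent μ (fun ω i => A i ω) = ∑ i, ent μ (A i)) :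
    ∑ i : Fin n, miFin μ (A i) (fun ω => (W ω, mask a₀ i fun j => A j ω)) =
      miFin μ (fun ω i => A i ω) W := by
  have hpi := FibM.pi hA
  have hm : ∀ i, FibM (fun ω => (W ω, mask a₀ i fun j => A j ω)) := fun i =>
    hW.prodMk (hpi.comp (mask a₀ i))
  set F : ℕ → ℝ := fun i => ent μ (fun ω => (W ω, mask a₀ i fun j => A j ω)) with hF
  have hstep : ∀ i : Fin n, miFin μ (A i) (fun ω => (W ω, mask a₀ i fun j => A j ω)) =
      ent μ (A i) - (F (i + 1) - F i) := by
    intro i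
    have : ent μ (fun ω => (A i ω, W ω, mask a₀ i fun j => A j ω)) = F (i + 1) := by
      refine ent_congr μ ((hA i).prodMk (hm i)) (hm (i + 1))
        (fun p => (p.2 i, p.1, mask a₀ i p.2))
        (fun p => (p.2.1, fun j => if j = i then p.1 else p.2.2 j)) (fun ω => ?_) (fun ω => ?_)
      · refine Prod.ext (by simp [mask]) (Prod.ext rfl (funext fun j => ?_))
        simp only [mask]
        grind
      · refine Prod.ext rfl (funext fun j => ?_)
        simp only [mask]
        grind
    simp only [miFin, this, hF]
    ring
  have h0 : F 0 = ent μ W :=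
    ent_congr μ (hm 0) hW (fun w => (w, fun _ => a₀)) Prod.fst (fun ω => by simp [mask, funext_iff])
      (fun _ => rfl)
  have hn : F n = ent μ (fun ω => ((fun i => A i ω), W ω)) :=
    ent_congr μ (hm n) (hpi.prodMk hW) Prod.swap Prod.swap (fun ω => by simp [funext_iff, mask])
      (fun ω => by simp [funext_iff, mask])
  simp_rw [hstep]
  rw [Finset.sum_sub_distrib, Fin.sum_univ_eq_sum_range (fun i => F (i + 1) - F i) n,
    Finset.sum_range_sub, h0, hn, miFin, hadd]
  ring

section Mixture

variable {n : ℕ} (υ : Measure (Fin n))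

lemma ent_mixture [SFinite υ] [IsProbabilityMeasure μ] (hυ : ∀ q, υ.real {q} = (n : ℝ)⁻¹)
    {B : Fin n → Ω → β} (hB : ∀ q, FibM (B q)) :
    ent (υ.prod μ) (fun p => (p.1, B p.1 p.2)) =
      (n : ℝ)⁻¹ * ∑ q, ent μ (B q) + n * negMulLog (n : ℝ)⁻¹ := by
  have h : ∀ q b, (υ.prod μ).real ((fun p => (p.1, B p.1 p.2)) ⁻¹' {(q, b)}) =
      (n : ℝ)⁻¹ * μ.real (B q ⁻¹' {b}) := by
    intro q b
    have : (fun p : Fin n × Ω => (p.1, B p.1 p.2)) ⁻¹' {(q, b)} = {q} ×ˢ (B q ⁻¹' {b}) := by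
      ext ⟨r, ω⟩
      simp only [Set.mem_preimage, Set.mem_singleton_iff, Prod.mk.injEq, Set.mem_prod]
      constructor <;> rintro ⟨rfl, h⟩ <;> exact ⟨rfl, h⟩
    rw [this, measureReal_prod_prod, hυ]
  have h2 : ∀ q, ∑ b, negMulLog ((n : ℝ)⁻¹ * μ.real (B q ⁻¹' {b})) =
      (n : ℝ)⁻¹ * ent μ (B q) + negMulLog (n : ℝ)⁻¹ := by
    intro q
    simp_rw [negMulLog_mul]
    rw [Finset.sum_add_distrib, ← Finset.sum_mul, sum_measureReal_fiber μ (hB q),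
      ← Finset.mul_sum, one_mul, add_comm]
    rfl
  have h3 : ent (υ.prod μ) (fun p => (p.1, B p.1 p.2)) =
      ∑ q, ∑ b, negMulLog ((n : ℝ)⁻¹ * μ.real (B q ⁻¹' {b})) := by
    rw [ent, Fintype.sum_prod_type]
    exact Finset.sum_congr rfl fun q _ => Finset.sum_congr rfl fun b _ => by rw [← h]; rfl
  rw [h3]
  simp_rw [h2]
  rw [Finset.sum_add_distrib, ← Finset.mul_sum]
  simp

lemma FibM.mixture {δ : Type*} {B : Fin n → Ω → δ} (hB : ∀ q, FibM (B q)) :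
    FibM (fun p : Fin n × Ω => (p.1, B p.1 p.2)) := fun ⟨q, b⟩ => by
  have : (fun p : Fin n × Ω => (p.1, B p.1 p.2)) ⁻¹' {(q, b)} = {q} ×ˢ (B q ⁻¹' {b}) := by
    ext ⟨r, ω⟩
    simp only [Set.mem_preimage, Set.mem_singleton_iff, Prod.mk.injEq, Set.mem_prod]
    constructor <;> rintro ⟨rfl, h⟩ <;> exact ⟨rfl, h⟩
  rw [this]
  exact (measurableSet_singleton q).prod (hB q b)

/-- Time sharing: if the law of `A q` does not depend on `q`, the mutual information between
`A Q` and `(Q, U Q)` with `Q` uniform is the average mutual information. -/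
lemma miFin_mixture [IsProbabilityMeasure υ] [IsProbabilityMeasure μ] (hn : 0 < n) (hυ : ∀ q, υ.real {q} = (n : ℝ)⁻¹)
    {A : Fin n → Ω → α} (hA : ∀ q, FibM (A q)) {U : Fin n → Ω → β} (hU : ∀ q, FibM (U q))
    (r : α → ℝ) (hr : ∀ q a, μ.real (A q ⁻¹' {a}) = r a) :
    miFin (υ.prod μ) (fun p => A p.1 p.2) (fun p => (p.1, U p.1 p.2)) =
      (n : ℝ)⁻¹ * ∑ q, miFin μ (A q) (U q) := by
  classical
  have hn' : (n : ℝ) ≠ 0 := by positivity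
  have hFA := FibM.mixture hA
  have hFU := FibM.mixture hU
  have hAU : ∀ q, FibM (fun ω => (A q ω, U q ω)) := fun q => (hA q).prodMk (hU q)
  have e1 : ent (υ.prod μ) (fun p => A p.1 p.2) = ∑ a, negMulLog (r a) := by
    refine Finset.sum_congr rfl fun a _ => ?_
    have h := measureReal_comp_fiber (υ.prod μ) hFA Prod.snd a
    rw [Finset.sum_filter, Fintype.sum_prod_type] at h
    have h2 : ∀ q, (υ.prod μ).real ((fun p => (p.1, A p.1 p.2)) ⁻¹' {(q, a)}) =
        (n : ℝ)⁻¹ * r a := by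
      intro q
      have : (fun p : Fin n × Ω => (p.1, A p.1 p.2)) ⁻¹' {(q, a)} = {q} ×ˢ (A q ⁻¹' {a}) := by
        ext ⟨s, ω⟩
        simp only [Set.mem_preimage, Set.mem_singleton_iff, Prod.mk.injEq, Set.mem_prod]
        constructor <;> rintro ⟨rfl, h⟩ <;> exact ⟨rfl, h⟩
      rw [this, measureReal_prod_prod, hυ, hr]
    simp only [Finset.sum_ite_eq', Finset.mem_univ, if_true, h2, Finset.sum_const,
      Finset.card_univ, Fintype.card_fin, nsmul_eq_mul, mul_inv_cancel_left₀ hn'] at h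
    change negMulLog ((υ.prod μ).real _) = _
    rw [h]
  have e2 : ∀ q, ent μ (A q) = ∑ a, negMulLog (r a) := fun q =>
    Finset.sum_congr rfl fun a _ => by rw [← hr q]; rfl
  have e3 : ent (υ.prod μ) (fun p => (A p.1 p.2, p.1, U p.1 p.2)) =
      ent (υ.prod μ) (fun p => (p.1, A p.1 p.2, U p.1 p.2)) :=
    ent_congr _ ((hFA.comp Prod.snd).prodMk hFU) (FibM.mixture hAU)
      (fun t => (t.2.1, t.1, t.2.2)) (fun t => (t.2.1, t.1, t.2.2)) (fun _ => rfl) (fun _ => rfl)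
  simp only [miFin, e3, ent_mixture μ υ hυ hU, ent_mixture μ υ hυ hAU, e1, e2,
    Finset.sum_sub_distrib, Finset.sum_add_distrib, Finset.sum_const, Finset.card_univ,
    Fintype.card_fin, nsmul_eq_mul]
  field_simp
  ring

end Mixture

lemma ent_map {Ω' : Type*} [MeasurableSpace Ω'] {G : Ω → Ω'} (hG : Measurable G) {A : Ω' → α}
    (hA : FibM A) : ent (μ.map G) A = ent μ (fun ω => A (G ω)) := by
  refine Finset.sum_congr rfl fun a _ => ?_
  rw [Measure.map_apply hG (hA a)]
  rfl

lemma miFin_map {Ω' : Type*} [MeasurableSpace Ω'] {G : Ω → Ω'} (hG : Measurable G) {A : Ω' → α}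
    {B : Ω' → β} (hA : FibM A) (hB : FibM B) :
    miFin (μ.map G) A B = miFin μ (fun ω => A (G ω)) (fun ω => B (G ω)) := by
  simp only [miFin, ent_map μ hG hA, ent_map μ hG hB, ent_map μ hG (hA.prodMk hB)]

lemma ofReal_miFin_le_miGen [IsProbabilityMeasure μ] [MeasurableSpace α]
    [MeasurableSingletonClass α] [MeasurableSpace β] [MeasurableSingletonClass β]
    {A : Ω → α} {B : Ω → β} (hA : FibM A) (hB : FibM B) :
    ENNReal.ofReal (miFin μ A B) ≤ miGen μ A B := by
  obtain ⟨ω⟩ := nonempty_of_isProbabilityMeasure μ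
  obtain ⟨k, hk⟩ := Nat.exists_eq_succ_of_ne_zero (Fintype.card_pos_iff.2 ⟨A ω⟩).ne'
  obtain ⟨l, hl⟩ := Nat.exists_eq_succ_of_ne_zero (Fintype.card_pos_iff.2 ⟨B ω⟩).ne'
  let e := Fintype.equivFinOfCardEq hk
  let e' := Fintype.equivFinOfCardEq hl
  have h : miFin μ A B ≤ miFin μ (e ∘ A) (e' ∘ B) := by
    have h1 := miFin_comp_left_le μ (hA.comp e) (hB.comp e') e.symm
    have h2 := miFin_comp_right_le μ hA (hB.comp e') e'.symm
    simp only [Equiv.symm_apply_apply] at h1 h2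
    exact h2.trans h1
  refine (ENNReal.ofReal_le_ofReal h).trans ?_
  exact le_iSup_of_le k <| le_iSup_of_le l <| le_iSup_of_le e <| le_iSup_of_le e' <|
    le_iSup_of_le (measurable_of_finite _) <| le_iSup_of_le (measurable_of_finite _) le_rfl

lemma miGen_le_ofReal_miFin [IsProbabilityMeasure μ] [MeasurableSpace α] [MeasurableSpace β]
    {A : Ω → α} {B : Ω → β} (hA : FibM A) (hB : FibM B) :
    miGen μ A B ≤ ENNReal.ofReal (miFin μ A B) := by
  refine iSup_le fun k => iSup_le fun l => iSup_le fun f => iSup_le fun g => iSup_le fun _ =>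
    iSup_le fun _ => ENNReal.ofReal_le_ofReal ?_
  exact miFin_le_of_factor μ hA hB f g (fun _ => rfl) (fun _ => rfl)

/-- Mutual information computed on two images of the same probability space. -/
lemma miFin_transfer {Ω' Ω'' : Type*} [MeasurableSpace Ω'] [MeasurableSpace Ω'']
    [IsProbabilityMeasure μ] {ρ : Measure Ω''} {G : Ω → Ω'} (hG : Measurable G) {Φ : Ω → Ω''}
    (hΦ : MeasurePreserving Φ μ ρ) {A : Ω' → α} {B : Ω' → γ} {A₀ : Ω'' → α} {B₀ : Ω'' → β}
    (hA : FibM A) (hB : FibM B) (hA₀ : FibM A₀) (hB₀ : FibM B₀) (e : β ≃ γ)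
    (hAG : ∀ ω, A (G ω) = A₀ (Φ ω)) (hBG : ∀ ω, B (G ω) = e (B₀ (Φ ω))) :
    miFin (μ.map G) A B = miFin ρ A₀ B₀ := by
  have hA' : FibM fun ω => A₀ (Φ ω) := fun a => hΦ.measurable (hA₀ a)
  have hB' : FibM fun ω => B₀ (Φ ω) := fun b => hΦ.measurable (hB₀ b)
  rw [miFin_map μ hG hA hB, ← hΦ.map_eq, miFin_map μ hΦ.measurable hA₀ hB₀]
  simp_rw [hAG, hBG]
  apply le_antisymm
  · exact miFin_comp_right_le μ hA' hB' e
  · simpa using miFin_comp_right_le μ hA' (hB'.comp e) e.symm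

section MarkovChain

variable {𝒵 𝒴 𝒳 R 𝒰 : Type*} [MeasurableSpace 𝒵] [MeasurableSpace 𝒴] [MeasurableSpace 𝒳]
  [MeasurableSpace R] [MeasurableSpace 𝒰]

/-- If `U = g(X, R)` with `R` independent of `(Z, Y, X)`, then `(Z, Y) ⊸ X ⊸ U`. -/
lemma markov_of_indep (ν : Measure (𝒵 × 𝒴 × 𝒳)) [IsProbabilityMeasure ν] (ρ : Measure R)
    [IsProbabilityMeasure ρ] {g : 𝒳 → R → 𝒰} (hg : Measurable (Function.uncurry g)) :
    Markov ((ν.prod ρ).map fun p => (p.1.1, p.1.2.1, p.1.2.2, g p.1.2.2 p.2))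
      (fun p => (p.1, p.2.1)) (fun p => p.2.2.1) (fun p => p.2.2.2) := by
  intro E F hE hF
  have hG : Measurable fun p : (𝒵 × 𝒴 × 𝒳) × R => (p.1.1, p.1.2.1, p.1.2.2, g p.1.2.2 p.2) := by
    have : Measurable fun p : (𝒵 × 𝒴 × 𝒳) × R => g p.1.2.2 p.2 :=
      hg.comp (f := fun p : (𝒵 × 𝒴 × 𝒳) × R => (p.1.2.2, p.2)) (by fun_prop)
    fun_prop
  set ν' := (ν.prod ρ).map fun p => (p.1.1, p.1.2.1, p.1.2.2, g p.1.2.2 p.2) with hν'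
  have : IsProbabilityMeasure ν' := Measure.isProbabilityMeasure_map hG.aemeasurable
  let V : 𝒵 × 𝒴 × 𝒳 × 𝒰 → 𝒵 × 𝒴 × 𝒳 := fun p => (p.1, p.2.1, p.2.2.1)
  have hV : Measurable V := by fun_prop
  have hVmap : ν'.map V = ν := by
    rw [hν', Measure.map_map hV hG]
    exact Measure.map_fst_prod.trans (by simp)
  have hindint : ∀ s : Set (𝒵 × 𝒴 × 𝒳 × 𝒰), MeasurableSet s → Integrable (ind s) ν' :=
    fun s hs => (integrable_const 1).indicator hs
  have hU : MeasurableSet ((fun p : 𝒵 × 𝒴 × 𝒳 × 𝒰 => p.2.2.2) ⁻¹' F) :=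
    (by fun_prop : Measurable fun p : 𝒵 × 𝒴 × 𝒳 × 𝒰 => p.2.2.2) hF
  set mX : MeasurableSpace (𝒵 × 𝒴 × 𝒳 × 𝒰) :=
    MeasurableSpace.comap (fun p => p.2.2.1) inferInstance
  let mV : MeasurableSpace (𝒵 × 𝒴 × 𝒳 × 𝒰) := MeasurableSpace.comap V inferInstance
  have hmV : mV ≤ Prod.instMeasurableSpace := hV.comap_le
  have hmXV : mX ≤ mV := by
    rintro _ ⟨t, ht, rfl⟩
    exact ⟨(fun w => w.2.2) ⁻¹' t, (by fun_prop : Measurable fun w : 𝒵 × 𝒴 × 𝒳 => w.2.2) ht, rfl⟩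
  let h : 𝒳 → ℝ := fun x => (ρ (g x ⁻¹' F)).toReal
  have hh0 : Measurable fun x => ρ (g x ⁻¹' F) := measurable_measure_prodMk_left (hg hF)
  have hh : Measurable h := hh0.ennreal_toReal
  have hhX : StronglyMeasurable[mX] fun p : 𝒵 × 𝒴 × 𝒳 × 𝒰 => h p.2.2.1 :=
    (hh.comp (comap_measurable _)).stronglyMeasurable
  have hhint : Integrable (fun p : 𝒵 × 𝒴 × 𝒳 × 𝒰 => h p.2.2.1) ν' := by
    refine Integrable.of_bound (hhX.mono (hmXV.trans hmV)).aestronglyMeasurable 1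
      (Filter.Eventually.of_forall fun p => ?_)
    rw [Real.norm_of_nonneg ENNReal.toReal_nonneg]
    exact measureReal_le_one
  have hZY : MeasurableSet[mV] ((fun p : 𝒵 × 𝒴 × 𝒳 × 𝒰 => (p.1, p.2.1)) ⁻¹' E) :=
    ⟨(fun w => (w.1, w.2.1)) ⁻¹' E,
      (by fun_prop : Measurable fun w : 𝒵 × 𝒴 × 𝒳 => (w.1, w.2.1)) hE, rfl⟩
  have key : (fun p => h p.2.2.1) =ᵐ[ν'] ν'[ind ((fun p => p.2.2.2) ⁻¹' F) | mV] := by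
    refine ae_eq_condExp_of_forall_setIntegral_eq hmV (hindint _ hU)
      (fun _ _ _ => hhint.integrableOn) ?_ (hhX.mono hmXV).aestronglyMeasurable
    rintro _ ⟨D, hD, rfl⟩ -
    have e1 : ∫ p in V ⁻¹' D, h p.2.2.1 ∂ν' = ∫ w in D, h w.2.2 ∂ν := by
      rw [← hVmap]
      exact (setIntegral_map (f := fun w => h w.2.2) hD
        (hh.comp (measurable_snd.comp measurable_snd)).aestronglyMeasurable hV.aemeasurable).symm
    rw [e1, ind, setIntegral_indicator hU, setIntegral_const, smul_eq_mul, mul_one,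
      integral_toReal (f := fun w : 𝒵 × 𝒴 × 𝒳 => ρ (g w.2.2 ⁻¹' F))
        (hh0.comp (measurable_snd.comp measurable_snd)).aemeasurable
        (Filter.Eventually.of_forall fun _ => measure_lt_top _ _),
      measureReal_def, hν', Measure.map_apply hG ((hV hD).inter hU), Measure.prod_apply
      (hG ((hV hD).inter hU)), ← lintegral_indicator hD]
    congr 1
    refine lintegral_congr fun w => ?_
    by_cases hw : w ∈ D
    · rw [Set.indicator_of_mem hw]
      congr 1
      ext r
      simp [V, hw]
    · rw [Set.indicator_of_notMem hw]
      symm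
      convert measure_empty (μ := ρ)
      ext r
      simp [V, hw]
  have hX : ν'[ind ((fun p => p.2.2.2) ⁻¹' F) | mX] =ᵐ[ν'] fun p => h p.2.2.1 := by
    refine (condExp_condExp_of_le hmXV hmV).symm.trans ((condExp_congr_ae key.symm).trans ?_)
    rw [condExp_of_stronglyMeasurable (hmXV.trans hmV) hhX hhint]
  have hmul : ind ((fun p : 𝒵 × 𝒴 × 𝒳 × 𝒰 => (p.1, p.2.1)) ⁻¹' E ∩ (fun p => p.2.2.2) ⁻¹' F) =
      ind ((fun p => (p.1, p.2.1)) ⁻¹' E) * ind ((fun p => p.2.2.2) ⁻¹' F) := by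
    classical
    ext p
    simp only [ind, Pi.mul_apply, Set.indicator_apply, Set.mem_inter_iff]
    split_ifs <;> simp_all
  have hEm : StronglyMeasurable[mV]
      (ind ((fun p : 𝒵 × 𝒴 × 𝒳 × 𝒰 => (p.1, p.2.1)) ⁻¹' E)) :=
    stronglyMeasurable_const.indicator hZY
  have hjoint : ν'[ind ((fun p : 𝒵 × 𝒴 × 𝒳 × 𝒰 => (p.1, p.2.1)) ⁻¹' E ∩
        (fun p => p.2.2.2) ⁻¹' F) | mV] =ᵐ[ν']
      ind ((fun p => (p.1, p.2.1)) ⁻¹' E) * fun p => h p.2.2.1 := by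
    rw [hmul]
    refine (condExp_mul_of_stronglyMeasurable_left hEm ?_ (hindint _ hU)).trans ?_
    · rw [← hmul]
      exact hindint _ ((hmV _ hZY).inter hU)
    · filter_upwards [key] with p hp
      simp only [Pi.mul_apply, ← hp]
  have hprod : Integrable (ind ((fun p : 𝒵 × 𝒴 × 𝒳 × 𝒰 => (p.1, p.2.1)) ⁻¹' E) *
      fun p => h p.2.2.1) ν' := integrable_condExp.congr hjoint
  refine (condExp_condExp_of_le hmXV hmV).symm.trans ((condExp_congr_ae hjoint).trans ?_)
  refine (condExp_mul_of_stronglyMeasurable_right hhX hprod (hindint _ (hmV _ hZY))).trans ?_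
  filter_upwards [hX] with p hp
  simp only [Pi.mul_apply, hp]

end MarkovChain

/-- Resampling one randomly chosen coordinate of an i.i.d. vector preserves its law. -/
lemma measurePreserving_update {S : Type*} [MeasurableSpace S] (P : Measure S)
    [IsProbabilityMeasure P] {n : ℕ} (q : Fin n) :
    MeasurePreserving (fun p : S × (Fin n → S) => Function.update p.2 q p.1)
      (P.prod (Measure.pi fun _ : Fin n => P)) (Measure.pi fun _ : Fin n => P) := by
  have hm : Measurable fun p : S × (Fin n → S) => Function.update p.2 q p.1 := by
    fun_prop
  refine ⟨hm, (Measure.pi_eq fun s hs => ?_).symm⟩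
  have : (fun p : S × (Fin n → S) => Function.update p.2 q p.1) ⁻¹' Set.univ.pi s =
      s q ×ˢ Set.univ.pi (Function.update s q Set.univ) := by
    ext ⟨x, v⟩
    simp only [Set.mem_preimage, Set.mem_univ_pi, Set.mem_prod]
    constructor
    · intro h
      refine ⟨by simpa using h q, fun j => ?_⟩
      by_cases hj : j = q
      · subst hj; simp
      · simpa [hj] using h j
    · rintro ⟨h1, h2⟩ j
      by_cases hj : j = q
      · subst hj; simpa using h1
      · simpa [hj] using h2 j
  rw [Measure.map_apply hm (MeasurableSet.univ_pi hs), this, Measure.prod_prod, Measure.pi_pi,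
    ← Finset.mul_prod_erase _ _ (Finset.mem_univ q), ← Finset.mul_prod_erase Finset.univ
    (fun i => P (s i)) (Finset.mem_univ q)]
  simp only [Function.update_self, measure_univ, one_mul]
  congr 1
  refine Finset.prod_congr rfl fun j hj => ?_
  rw [Function.update_of_ne (Finset.ne_of_mem_erase hj)]

end FiniteEntropy

/-- Proposition 10 of the paper: for finite `𝒴` and arbitrary `𝒳`, `𝒵`, any
measurable `f : 𝒳ⁿ → M` and `ε > 0`, there is an extension of `μZYX` by a finite-alphabet `U`
with `(Z,Y) ⊸ X ⊸ U`, `I(X;U) ≤ (1/n) log |M|` and `I(Y;U) ≥ (1/n) I(Yⁿ; f(Xⁿ)) − ε`. -/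
theorem outer_bound_general_X
    {𝒵 𝒴 𝒳 : Type*} [MeasurableSpace 𝒵]
    [Fintype 𝒴] [MeasurableSpace 𝒴] [MeasurableSingletonClass 𝒴]
    [MeasurableSpace 𝒳]
    (μZYX : Measure (𝒵 × 𝒴 × 𝒳)) [IsProbabilityMeasure μZYX]
    (n : ℕ) (hn : 0 < n) {M : Type*} [Fintype M] [MeasurableSpace M]
    [MeasurableSingletonClass M] (f : (Fin n → 𝒳) → M) (hf : Measurable f)
    (ε : ℝ) (hε : 0 < ε) :
    ∃ (k : ℕ) (μ' : Measure (𝒵 × 𝒴 × 𝒳 × Fin (k + 1))),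
      IsProbabilityMeasure μ' ∧
      Measure.map (fun p => (p.1, p.2.1, p.2.2.1)) μ' = μZYX ∧
      Markov μ' (fun p => (p.1, p.2.1)) (fun p => p.2.2.1) (fun p => p.2.2.2) ∧
      miGen μ' (fun p => p.2.2.1) (fun p => p.2.2.2) ≤
        ENNReal.ofReal (Real.log (Fintype.card M) / n) ∧
      miGen (Measure.pi fun _ : Fin n => Measure.map (fun p => (p.2.1, p.2.2)) μZYX)
          (fun ω i => (ω i).1) (fun ω => f fun i => (ω i).2) / (n : ℝ≥0∞)
          - ENNReal.ofReal ε ≤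
        miGen μ' (fun p => p.2.1) (fun p => p.2.2.2) := by
  classical
  have hYX : Measurable fun p : 𝒵 × 𝒴 × 𝒳 => (p.2.1, p.2.2) := by fun_prop
  set P : Measure (𝒴 × 𝒳) := Measure.map (fun p => (p.2.1, p.2.2)) μZYX with hP
  have : IsProbabilityMeasure P := Measure.isProbabilityMeasure_map hYX.aemeasurable
  obtain ⟨w₀⟩ := nonempty_of_isProbabilityMeasure μZYX
  set y₀ : 𝒴 := w₀.2.1
  have hne : Nonempty (Fin n) := ⟨⟨0, hn⟩⟩
  have hneY : Nonempty 𝒴 := ⟨y₀⟩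
  have hneM : Nonempty M := ⟨f fun _ => w₀.2.2⟩
  have hn' : (0 : ℝ) < n := by exact_mod_cast hn
  set κ : Measure (Fin n → 𝒴 × 𝒳) := Measure.pi fun _ => P with hκ
  let υ : Measure (Fin n) := ProbabilityTheory.uniformOn Set.univ
  have : IsProbabilityMeasure υ :=
    ProbabilityTheory.isProbabilityMeasure_uniformOn Set.finite_univ Set.univ_nonempty
  have hυ : ∀ q, υ.real {q} = (n : ℝ)⁻¹ := fun q => by
    simp [υ, measureReal_def, ProbabilityTheory.uniformOn_univ]
  let W : (Fin n → 𝒴 × 𝒳) → M := fun ω => f fun i => (ω i).2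
  have hW : FibM W := FibM.of_measurable (hf.comp (by fun_prop))
  let U : Fin n → (Fin n → 𝒴 × 𝒳) → M × (Fin n → 𝒴) :=
    fun q ω => (W ω, mask y₀ q fun j => (ω j).1)
  have hY : ∀ i : Fin n, FibM fun ω : Fin n → 𝒴 × 𝒳 => (ω i).1 := fun i =>
    FibM.of_measurable (by fun_prop)
  have hUq : ∀ q, FibM (U q) := fun q => hW.prodMk ((FibM.pi hY).comp (mask y₀ q))
  obtain ⟨k, hk⟩ := Nat.exists_eq_succ_of_ne_zero
    (Fintype.card_ne_zero (α := Fin n × M × (Fin n → 𝒴)))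
  let e : Fin n × M × (Fin n → 𝒴) ≃ Fin (k + 1) := Fintype.equivFinOfCardEq hk
  let g : 𝒳 → Fin n × (Fin n → 𝒴 × 𝒳) → Fin (k + 1) := fun x r =>
    e (r.1, f (Function.update (fun j => (r.2 j).2) r.1 x), mask y₀ r.1 fun j => (r.2 j).1)
  have hg : Measurable (Function.uncurry g) := by
    have h1 : Measurable fun p : 𝒳 × Fin n × (Fin n → 𝒴 × 𝒳) =>
        Function.update (fun j => (p.2.2 j).2) p.2.1 p.1 := by
      refine measurable_pi_lambda _ fun j => ?_
      simp only [Function.update_apply]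
      exact Measurable.ite ((measurable_fst.comp measurable_snd)
        (MeasurableSet.of_discrete (s := {q | j = q}))) (by fun_prop) (by fun_prop)
    have h2 : Measurable fun p : 𝒳 × Fin n × (Fin n → 𝒴 × 𝒳) =>
        (mask y₀ p.2.1 fun j => (p.2.2 j).1 : Fin n → 𝒴) := by
      refine measurable_pi_lambda _ fun j => ?_
      exact Measurable.ite ((measurable_fst.comp measurable_snd)
        (MeasurableSet.of_discrete (s := {q : Fin n | (j : ℕ) < q}))) (by fun_prop) (by fun_prop)
    exact (measurable_of_finite e).comp
      ((measurable_fst.comp measurable_snd).prodMk ((hf.comp h1).prodMk h2))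
  let G : (𝒵 × 𝒴 × 𝒳) × Fin n × (Fin n → 𝒴 × 𝒳) → 𝒵 × 𝒴 × 𝒳 × Fin (k + 1) :=
    fun p => (p.1.1, p.1.2.1, p.1.2.2, g p.1.2.2 p.2)
  have hG : Measurable G := by
    have : Measurable fun p : (𝒵 × 𝒴 × 𝒳) × Fin n × (Fin n → 𝒴 × 𝒳) => g p.1.2.2 p.2 :=
      hg.comp (f := fun p : (𝒵 × 𝒴 × 𝒳) × Fin n × (Fin n → 𝒴 × 𝒳) => (p.1.2.2, p.2))
        (by fun_prop)
    fun_prop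
  let ν := μZYX.prod (υ.prod κ)
  have hprob : IsProbabilityMeasure (ν.map G) := Measure.isProbabilityMeasure_map hG.aemeasurable
  let Φ : (𝒵 × 𝒴 × 𝒳) × Fin n × (Fin n → 𝒴 × 𝒳) → Fin n × (Fin n → 𝒴 × 𝒳) :=
    fun p => (p.2.1, Function.update p.2.2 p.2.1 p.1.2)
  have hΦ : MeasurePreserving Φ ν (υ.prod κ) := by
    have h1 : MeasurePreserving
        (fun p : Fin n × (𝒵 × 𝒴 × 𝒳) × (Fin n → 𝒴 × 𝒳) =>
          (p.1, Function.update p.2.2 p.1 p.2.1.2)) (υ.prod (μZYX.prod κ)) (υ.prod κ) := by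
      refine MeasurePreserving.skew_product
        (g := fun q (p : (𝒵 × 𝒴 × 𝒳) × (Fin n → 𝒴 × 𝒳)) => Function.update p.2 q p.1.2)
        (MeasurePreserving.id υ) ?_
        (Filter.Eventually.of_forall fun q => ?_)
      · exact measurable_from_prod_countable_right fun q =>
          (measurePreserving_update P q).measurable.comp
            (f := fun p : (𝒵 × 𝒴 × 𝒳) × (Fin n → 𝒴 × 𝒳) => (p.1.2, p.2)) (by fun_prop)
      · have hYX' : MeasurePreserving (fun p : 𝒵 × 𝒴 × 𝒳 => p.2) μZYX P := ⟨by fun_prop, rfl⟩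
        exact ((measurePreserving_update P q).comp
          (hYX'.prod (MeasurePreserving.id κ))).map_eq
    exact h1.comp ((measurePreserving_prodAssoc υ μZYX κ).comp
      ((Measure.measurePreserving_swap.prod (MeasurePreserving.id κ)).comp
        (measurePreserving_prodAssoc μZYX υ κ).symm))
  have hB : FibM (fun p : 𝒵 × 𝒴 × 𝒳 × Fin (k + 1) => p.2.2.2) :=
    FibM.of_measurable (by fun_prop)
  have hGU : ∀ p, (G p).2.2.2 = e ((Φ p).1, U (Φ p).1 (Φ p).2) := by
    rintro ⟨w, q, ω⟩
    simp only [G, g, Φ, U, W, EmbeddingLike.apply_eq_iff_eq, Prod.mk.injEq, true_and]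
    constructor
    · congr 1
      ext j
      by_cases hj : j = q
      · subst hj; simp
      · simp [hj]
    · funext j
      simp only [mask]
      split_ifs with hj
      · rw [Function.update_of_ne (fun h => by simp [h] at hj)]
      · rfl
  refine ⟨k, ν.map G, hprob, ?_, markov_of_indep μZYX (υ.prod κ) hg, ?_, ?_⟩
  · rw [Measure.map_map (by fun_prop) hG]
    exact Measure.map_fst_prod.trans (by simp)
  · refine iSup_le fun l => iSup_le fun l' => iSup_le fun φ => iSup_le fun ψ => iSup_le fun hφ =>
      iSup_le fun _ => ENNReal.ofReal_le_ofReal ?_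
    let A : Fin n → (Fin n → 𝒴 × 𝒳) → 𝒴 × Fin (l + 1) := fun i ω => ((ω i).1, φ (ω i).2)
    have hA : ∀ i, FibM (A i) := fun i => FibM.of_measurable (by fun_prop)
    have hX : ∀ i : Fin n, FibM fun ω : Fin n → 𝒴 × 𝒳 => φ (ω i).2 := fun i =>
      (hA i).comp Prod.snd
    have hX' : FibM (fun p : 𝒵 × 𝒴 × 𝒳 × Fin (k + 1) => φ p.2.2.1) :=
      FibM.of_measurable (by fun_prop)
    have hWA : ∀ q : Fin n, FibM fun ω => (W ω, mask (y₀, φ w₀.2.2) q fun j => A j ω) :=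
      fun q => hW.prodMk ((FibM.pi hA).comp (mask (y₀, φ w₀.2.2) q))
    have hφ₂ : Measurable fun s : 𝒴 × 𝒳 => φ s.2 := by fun_prop
    have hle : ∀ q : Fin n, miFin κ (fun ω => φ (ω q).2) (U q) ≤
        miFin κ (A q) (fun ω => (W ω, mask (y₀, φ w₀.2.2) q fun j => A j ω)) := by
      intro q
      refine miFin_le_of_factor κ (hA q) (hWA q) Prod.snd (fun t => (t.1, fun j => (t.2 j).1))
        (fun _ => rfl) (fun ω => Prod.ext rfl (funext fun j => ?_))
      simp only [U, mask, A]
      split_ifs <;> rfl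
    calc miFin (ν.map G) (fun p => φ p.2.2.1) (fun p => ψ p.2.2.2)
        ≤ miFin (ν.map G) (fun p => φ p.2.2.1) (fun p => p.2.2.2) :=
          miFin_comp_right_le _ hX' hB ψ
      _ = (n : ℝ)⁻¹ * ∑ q, miFin κ (fun ω => φ (ω q).2) (U q) := by
          rw [miFin_transfer ν hG hΦ (A₀ := fun p => φ (p.2 p.1).2)
            (B₀ := fun p => (p.1, U p.1 p.2)) hX' hB
            ((FibM.mixture hX).comp Prod.snd) (FibM.mixture hUq) e (fun p => by simp [G, Φ]) hGU,
            miFin_mixture κ υ hn hυ hX hUq (fun a => P.real ((fun s => φ s.2) ⁻¹' {a}))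
            (fun q a => measureReal_pi_eval P q (hφ₂ (measurableSet_singleton a)))]
      _ ≤ (n : ℝ)⁻¹ * ∑ q : Fin n, miFin κ (A q)
            (fun ω => (W ω, mask (y₀, φ w₀.2.2) q fun j => A j ω)) := by
          gcongr with q
          exact hle q
      _ = (n : ℝ)⁻¹ * miFin κ (fun ω i => A i ω) W := by
          rw [sum_miFin_mask κ _ hA hW (ent_pi P (φ := fun s => (s.1, φ s.2))
            (FibM.of_measurable (by fun_prop)))]
      _ ≤ (n : ℝ)⁻¹ * log (Fintype.card M) := by
          gcongr
          exact (miFin_le_ent κ (FibM.pi hA) hW).trans (ent_le_log_card κ hW)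
      _ = log (Fintype.card M) / n := by rw [div_eq_inv_mul]
  · refine tsub_le_self.trans ?_
    have h1 : miFin (ν.map G) (fun p => p.2.1) (fun p => p.2.2.2) =
        (n : ℝ)⁻¹ * miFin κ (fun ω i => (ω i).1) W := by
      rw [miFin_transfer ν hG hΦ (A₀ := fun p => (p.2 p.1).1)
        (B₀ := fun p => (p.1, U p.1 p.2)) (FibM.of_measurable (by fun_prop)) hB
        ((FibM.mixture hY).comp Prod.snd) (FibM.mixture hUq) e (fun p => by simp [G, Φ]) hGU,
        miFin_mixture κ υ hn hυ hY hUq (fun y => P.real (Prod.fst ⁻¹' {y}))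
        (fun q y => measureReal_pi_eval P q (measurable_fst (measurableSet_singleton y))),
        ← sum_miFin_mask κ y₀ hY hW
          (ent_pi P (φ := Prod.fst) (FibM.of_measurable measurable_fst))]
    have h2 := ofReal_miFin_le_miGen (ν.map G) (A := fun p => p.2.1)
      (FibM.of_measurable (by fun_prop)) hB
    refine le_trans ?_ h2
    rw [h1, ENNReal.ofReal_mul (by positivity), ENNReal.ofReal_inv_of_pos hn',
      ENNReal.ofReal_natCast, mul_comm, ← div_eq_mul_inv]
    exact ENNReal.div_le_div_right (miGen_le_ofReal_miFin κ (FibM.pi hY) hW) _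

end IB
end
end

section
/- Data processing inequality on arbitrary alphabets: for random variables X, Y, Z with values in arbitrary measurable spaces, if the Markov chain X ⊸ Y ⊸ Z holds, then I(X;Y) ≥ I(X;Z). -/
open MeasureTheory Real
open scoped ENNReal

noncomputable section

namespace IB

section Discrete

variable {ι τ κ : Type*} [Fintype ι] [Fintype τ] [Fintype κ]

/-- Scaling identity for the entropy of a finite nonnegative vector. -/
lemma sum_negMulLog_eq (p : ι → ℝ) (hp : ∀ i, 0 ≤ p i) {q : ℝ} (hq : ∑ i, p i = q) :
    ∑ i, negMulLog (p i) = negMulLog q + q * ∑ i, negMulLog (p i / q) := by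
  rcases eq_or_ne q 0 with rfl | h0
  · have h := (Finset.sum_eq_zero_iff_of_nonneg fun i _ => hp i).1 hq
    simp only [Finset.mem_univ, true_implies] at h
    simp [h]
  · have key : ∀ i, negMulLog (p i) = (p i / q) * negMulLog q + q * negMulLog (p i / q) := by
      intro i
      rw [← negMulLog_mul, mul_div_cancel₀ _ h0]
    rw [Finset.sum_congr rfl fun i _ => key i, Finset.sum_add_distrib, ← Finset.sum_mul,
      ← Finset.sum_div, hq, div_self h0, one_mul, Finset.mul_sum]

/-- Jensen's inequality for `negMulLog` with unnormalized weights. -/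
lemma sum_mul_negMulLog_le (w x : τ → ℝ) (hw : ∀ t, 0 ≤ w t) (hx : ∀ t, 0 ≤ x t) :
    ∑ t, w t * negMulLog (x t) ≤
      (∑ t, w t) * negMulLog ((∑ t, w t * x t) / ∑ t, w t) := by
  rcases eq_or_ne (∑ t, w t) 0 with h0 | h0
  · have h := (Finset.sum_eq_zero_iff_of_nonneg fun t _ => hw t).1 h0
    simp only [Finset.mem_univ, true_implies] at h
    simp [h]
  · have hpos : 0 < ∑ t, w t := lt_of_le_of_ne (Finset.sum_nonneg fun t _ => hw t) h0.symm
    have := concaveOn_negMulLog.le_map_sum (t := Finset.univ)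
      (w := fun t => w t / ∑ t, w t) (p := x) (fun t _ => div_nonneg (hw t) hpos.le)
      (by rw [← Finset.sum_div, div_self h0]) (fun t _ => hx t)
    simp only [smul_eq_mul, div_mul_eq_mul_div, ← Finset.sum_div] at this
    rwa [div_le_iff₀' hpos] at this

/-- Data processing for finite alphabets: `a` is the joint law of `(U, T)`, `b` the joint law of
`(T, V)`, and `U` and `V` are coupled conditionally independently given `T`. -/
lemma sum_negMulLog_sub_le (a : ι → τ → ℝ) (b : τ → κ → ℝ) (m : τ → ℝ)
    (ha : ∀ i t, 0 ≤ a i t) (hb : ∀ t j, 0 ≤ b t j)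
    (ham : ∀ t, ∑ i, a i t = m t) (hbm : ∀ t, ∑ j, b t j = m t) :
    ∑ j, negMulLog (∑ t, b t j) - ∑ i, ∑ j, negMulLog (∑ t, a i t * b t j / m t) ≤
      ∑ t, negMulLog (m t) - ∑ i, ∑ t, negMulLog (a i t) := by
  have hm : ∀ t, 0 ≤ m t := fun t => ham t ▸ Finset.sum_nonneg fun i _ => ha i t
  have hb0 : ∀ t j, m t = 0 → b t j = 0 := fun t j h =>
    (Finset.sum_eq_zero_iff_of_nonneg fun j _ => hb t j).1 ((hbm t).trans h) j (Finset.mem_univ j)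
  have hT : ∑ i, ∑ t, negMulLog (a i t) =
      ∑ t, negMulLog (m t) + ∑ t, m t * ∑ i, negMulLog (a i t / m t) := by
    rw [Finset.sum_comm, ← Finset.sum_add_distrib]
    exact Finset.sum_congr rfl fun t _ => sum_negMulLog_eq _ (fun i => ha i t) (ham t)
  have hV : ∑ i, ∑ j, negMulLog (∑ t, a i t * b t j / m t) =
      ∑ j, negMulLog (∑ t, b t j) + ∑ j, (∑ t, b t j) *
        ∑ i, negMulLog ((∑ t, a i t * b t j / m t) / ∑ t, b t j) := by
    rw [Finset.sum_comm, ← Finset.sum_add_distrib]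
    refine Finset.sum_congr rfl fun j _ => sum_negMulLog_eq _ (fun i => ?_) ?_
    · exact Finset.sum_nonneg fun t _ => div_nonneg (mul_nonneg (ha i t) (hb t j)) (hm t)
    · rw [Finset.sum_comm]
      refine Finset.sum_congr rfl fun t _ => ?_
      rw [← Finset.sum_div, ← Finset.sum_mul, ham]
      rcases eq_or_ne (m t) 0 with h | h
      · simp [hb0 t j h]
      · field_simp
  have hJ : ∑ t, m t * ∑ i, negMulLog (a i t / m t) ≤ ∑ j, (∑ t, b t j) *
        ∑ i, negMulLog ((∑ t, a i t * b t j / m t) / ∑ t, b t j) := by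
    calc ∑ t, m t * ∑ i, negMulLog (a i t / m t)
        = ∑ j, ∑ i, ∑ t, b t j * negMulLog (a i t / m t) := by
          simp_rw [← hbm, Finset.sum_mul, Finset.mul_sum]
          rw [Finset.sum_comm]
          exact Finset.sum_congr rfl fun j _ => Finset.sum_comm
      _ ≤ _ := by
          refine Finset.sum_le_sum fun j _ => ?_
          rw [Finset.mul_sum]
          refine Finset.sum_le_sum fun i _ => ?_
          refine (sum_mul_negMulLog_le (fun t => b t j) (fun t => a i t / m t)
            (fun t => hb t j) (fun t => div_nonneg (ha i t) (hm t))).trans_eq ?_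
          simp_rw [mul_div_assoc', mul_comm (b _ j)]
  linarith

end Discrete

section Measure

variable {Ω : Type*} [MeasurableSpace Ω] {μ : Measure Ω}

lemma miFin_eq {α β : Type*} [Fintype α] [Fintype β] (μ : Measure Ω) (A : Ω → α) (B : Ω → β) :
    miFin μ A B = ∑ a, negMulLog (μ.real (A ⁻¹' {a})) + (∑ b, negMulLog (μ.real (B ⁻¹' {b})) -
      ∑ a, ∑ b, negMulLog (μ.real (A ⁻¹' {a} ∩ B ⁻¹' {b}))) := by
  have h : ∀ a b, (fun ω => (A ω, B ω)) ⁻¹' {(a, b)} = A ⁻¹' {a} ∩ B ⁻¹' {b} := by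
    intro a b
    ext ω
    simp
  simp only [miFin, ent, Fintype.sum_prod_type, h, Measure.real]
  ring

/-- Quantizing the second variable in any nonempty finite type bounds `miGen` from below. -/
lemma ofReal_miFin_le_miGen_s9 {α β τ : Type*} [MeasurableSpace α] [MeasurableSpace β]
    [Fintype τ] [Nonempty τ] (A : Ω → α) (B : Ω → β) {k : ℕ} {f : α → Fin (k + 1)}
    (hf : Measurable f) {g : β → τ} (hg : ∀ t, MeasurableSet (g ⁻¹' {t})) :
    ENNReal.ofReal (miFin μ (f ∘ A) (g ∘ B)) ≤ miGen μ A B := by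
  obtain ⟨l, hl⟩ := Nat.exists_eq_succ_of_ne_zero (Fintype.card_ne_zero (α := τ))
  let e : τ ≃ Fin (l + 1) := Fintype.equivFinOfCardEq hl
  have hpre : ∀ t, (e ∘ g) ⁻¹' {e t} = g ⁻¹' {t} := by
    intro t
    ext y
    simp
  have heg : Measurable (e ∘ g) := measurable_to_countable' fun s => by
    rw [← e.apply_symm_apply s, hpre]
    exact hg _
  have heq : miFin μ (f ∘ A) (g ∘ B) = miFin μ (f ∘ A) ((e ∘ g) ∘ B) := by
    have hpre' : ∀ t, ((e ∘ g) ∘ B) ⁻¹' {e t} = (g ∘ B) ⁻¹' {t} := fun t => by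
      rw [Set.preimage_comp, hpre, Set.preimage_comp]
    simp_rw [miFin_eq, ← e.sum_comp, hpre']
  rw [heq]
  exact le_iSup_of_le k <| le_iSup_of_le l <| le_iSup_of_le f <| le_iSup_of_le (e ∘ g) <|
    le_iSup_of_le hf <| le_iSup_of_le heg le_rfl

/-- If `p` varies by at most `δ` on `A`, then averaging `p` over `A` changes `∫ p q` by at most
`δ ∫ q`. -/
lemma abs_setIntegral_mul_sub_le [IsFiniteMeasure μ] {A : Set Ω} (hA : MeasurableSet A)
    {p q : Ω → ℝ} (hp : Integrable p μ) (hq : Integrable q μ)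
    (hpq : Integrable (fun ω => p ω * q ω) μ) {c δ : ℝ}
    (hpc : ∀ᵐ ω ∂μ, ω ∈ A → p ω ∈ Set.Icc c (c + δ)) (hq0 : 0 ≤ᵐ[μ] q) :
    |∫ ω in A, p ω * q ω ∂μ - (∫ ω in A, p ω ∂μ) * (∫ ω in A, q ω ∂μ) / μ.real A| ≤
      δ * ∫ ω in A, q ω ∂μ := by
  rcases eq_or_ne (μ.real A) 0 with h0 | h0
  · have : μ.restrict A = 0 := by
      rw [Measure.restrict_eq_zero]
      exact (measureReal_eq_zero_iff).1 h0
    simp [this]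
  have hpos : 0 < μ.real A := lt_of_le_of_ne measureReal_nonneg h0.symm
  have hQ : 0 ≤ ∫ ω in A, q ω ∂μ := setIntegral_nonneg_of_ae hq0
  have h1 : c * μ.real A ≤ ∫ ω in A, p ω ∂μ := by
    have := setIntegral_mono_on_ae (integrable_const c).integrableOn hp.integrableOn hA
      (hpc.mono fun ω h hω => (h hω).1)
    simpa [mul_comm] using this
  have h2 : ∫ ω in A, p ω ∂μ ≤ (c + δ) * μ.real A := by
    have := setIntegral_mono_on_ae hp.integrableOn (integrable_const (c + δ)).integrableOn hA
      (hpc.mono fun ω h hω => (h hω).2)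
    simpa [mul_comm] using this
  have h3 : c * ∫ ω in A, q ω ∂μ ≤ ∫ ω in A, p ω * q ω ∂μ := by
    rw [← integral_const_mul]
    refine setIntegral_mono_on_ae (hq.const_mul c).integrableOn hpq.integrableOn hA ?_
    filter_upwards [hpc, hq0] with ω h hω hωA
    exact mul_le_mul_of_nonneg_right (h hωA).1 hω
  have h4 : ∫ ω in A, p ω * q ω ∂μ ≤ (c + δ) * ∫ ω in A, q ω ∂μ := by
    rw [← integral_const_mul]
    refine setIntegral_mono_on_ae hpq.integrableOn (hq.const_mul (c + δ)).integrableOn hA ?_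
    filter_upwards [hpc, hq0] with ω h hω hωA
    exact mul_le_mul_of_nonneg_right (h hωA).2 hω
  rw [mul_div_right_comm]
  have h5 := mul_le_mul_of_nonneg_right ((le_div_iff₀ hpos).2 h1) hQ
  have h6 := mul_le_mul_of_nonneg_right ((div_le_iff₀ hpos).2 h2) hQ
  rw [abs_le]
  constructor <;> linarith

lemma integrable_ind [IsFiniteMeasure μ] {S : Set Ω} (hS : MeasurableSet S) :
    Integrable (ind S) μ :=
  (integrable_const (1 : ℝ)).indicator hS

lemma sum_measureReal_inter_preimage_singleton [IsFiniteMeasure μ] {τ : Type*} [Fintype τ]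
    (R : Set Ω) {T : Ω → τ} (hT : ∀ t, MeasurableSet (T ⁻¹' {t})) :
    ∑ t, μ.real (R ∩ T ⁻¹' {t}) = μ.real R := by
  have := sum_measureReal_preimage_singleton (μ := μ.restrict R) Finset.univ (f := T)
    fun t _ => hT t
  simp only [Finset.coe_univ, Set.preimage_univ, measureReal_restrict_apply_univ] at this
  rw [← this]
  refine Finset.sum_congr rfl fun t _ => ?_
  rw [measureReal_restrict_apply (hT t), Set.inter_comm]

end Measure

section CondExp

variable {Ω : Type*} {m m₀ : MeasurableSpace Ω} {μ : Measure Ω}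

lemma condExp_ind_mem_Icc [IsFiniteMeasure μ] (hm : m ≤ m₀) {S : Set Ω} (hS : MeasurableSet S) :
    ∀ᵐ ω ∂μ, (μ[ind S | m]) ω ∈ Set.Icc (0 : ℝ) 1 := by
  have h0 : 0 ≤ᵐ[μ] μ[ind S | m] :=
    condExp_nonneg (.of_forall fun ω => Set.indicator_nonneg (fun _ _ => zero_le_one) ω)
  have h1 : μ[ind S | m] ≤ᵐ[μ] μ[fun _ => (1 : ℝ) | m] :=
    condExp_mono (integrable_ind hS) (integrable_const 1)
      (.of_forall fun ω => Set.indicator_le_self' (fun _ _ => zero_le_one) ω)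
  rw [condExp_const hm] at h1
  filter_upwards [h0, h1] with ω h h' using ⟨h, h'⟩

lemma setIntegral_condExp_ind [IsFiniteMeasure μ] (hm : m ≤ m₀) {S A : Set Ω} (hS : MeasurableSet S)
    (hA : MeasurableSet[m] A) : ∫ ω in A, (μ[ind S | m]) ω ∂μ = μ.real (S ∩ A) := by
  rw [setIntegral_condExp hm (integrable_ind hS) hA, ind, integral_indicator_const _ hS]
  simp [measureReal_restrict_apply hS]

/-- If `S` and `S'` are conditionally independent given `m` and the `m`-measurable quantizer `T`
determines `P(S | m)` up to `δ`, then `P(S ∩ S')` is within `δ` of its value under conditional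
independence given `T`. -/
lemma abs_measureReal_inter_sub_le [IsProbabilityMeasure μ] {τ : Type*} [Fintype τ]
    (hm : m ≤ m₀) {S S' : Set Ω}
    (hS : MeasurableSet S) (hS' : MeasurableSet S')
    (hind : μ[ind (S ∩ S') | m] =ᵐ[μ] fun ω => (μ[ind S | m]) ω * (μ[ind S' | m]) ω)
    {T : Ω → τ} (hT : ∀ t, MeasurableSet[m] (T ⁻¹' {t})) {c : τ → ℝ} {δ : ℝ} (hδ : 0 ≤ δ)
    (hc : ∀ᵐ ω ∂μ, (μ[ind S | m]) ω ∈ Set.Icc (c (T ω)) (c (T ω) + δ)) :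
    |μ.real (S ∩ S') - ∑ t, μ.real (S ∩ T ⁻¹' {t}) * μ.real (S' ∩ T ⁻¹' {t}) /
      μ.real (T ⁻¹' {t})| ≤ δ := by
  have hsum : ∀ R : Set Ω, μ.real R = ∑ t, μ.real (R ∩ T ⁻¹' {t}) := fun R =>
    (sum_measureReal_inter_preimage_singleton R fun t => hm _ (hT t)).symm
  have hpq : Integrable (fun ω => (μ[ind S | m]) ω * (μ[ind S' | m]) ω) μ :=
    integrable_condExp.congr hind
  rw [hsum (S ∩ S'), ← Finset.sum_sub_distrib]
  refine (Finset.abs_sum_le_sum_abs _ _).trans ?_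
  calc _ ≤ ∑ t, δ * μ.real (S' ∩ T ⁻¹' {t}) := by
        refine Finset.sum_le_sum fun t _ => ?_
        have hA := hm _ (hT t)
        have hcA : ∀ᵐ ω ∂μ, ω ∈ T ⁻¹' {t} → (μ[ind S | m]) ω ∈ Set.Icc (c t) (c t + δ) := by
          filter_upwards [hc] with ω h hω
          rw [Set.mem_preimage, Set.mem_singleton_iff] at hω
          rwa [hω] at h
        have := abs_setIntegral_mul_sub_le hA integrable_condExp integrable_condExp hpq
          hcA
          ((condExp_ind_mem_Icc hm hS').mono fun ω h => h.1)
        rwa [← setIntegral_congr_ae hA (hind.mono fun ω h _ => h),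
          setIntegral_condExp_ind hm (hS.inter hS') (hT t), setIntegral_condExp_ind hm hS (hT t),
          setIntegral_condExp_ind hm hS' (hT t)] at this
    _ = δ * μ.real S' := by rw [← Finset.mul_sum, ← hsum]
    _ ≤ δ := mul_le_of_le_one_right hδ measureReal_le_one

end CondExp

/-- Index of the cell of the grid of mesh `1 / (n + 1)` containing a point of `[0, 1]`. -/
def gridIndex (n : ℕ) (x : ℝ) : Fin (n + 2) :=
  ⟨min ⌊(n + 1 : ℝ) * x⌋₊ (n + 1), by omega⟩

lemma measurable_gridIndex (n : ℕ) : Measurable (gridIndex n) := by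
  refine measurable_to_countable' fun t => ?_
  have h : Measurable fun x : ℝ => min ⌊(n + 1 : ℝ) * x⌋₊ (n + 1) := by fun_prop
  convert h (measurableSet_singleton (t : ℕ)) using 1
  ext x
  simp [gridIndex, Fin.ext_iff]

lemma mem_Icc_gridIndex (n : ℕ) {x : ℝ} (hx : x ∈ Set.Icc (0 : ℝ) 1) :
    x ∈ Set.Icc ((gridIndex n x : ℕ) / (n + 1 : ℝ))
      ((gridIndex n x : ℕ) / (n + 1 : ℝ) + 1 / (n + 1 : ℝ)) := by
  have hn : (0 : ℝ) < n + 1 := by positivity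
  have hle : ⌊(n + 1 : ℝ) * x⌋₊ ≤ n + 1 := by
    refine Nat.floor_le_of_le ?_
    push_cast
    exact mul_le_of_le_one_right hn.le hx.2
  have hval : (gridIndex n x : ℕ) = ⌊(n + 1 : ℝ) * x⌋₊ := min_eq_left hle
  rw [hval, ← add_div, Set.mem_Icc, div_le_iff₀' hn, le_div_iff₀' hn]
  exact ⟨Nat.floor_le (mul_nonneg hn.le hx.1), (Nat.lt_floor_add_one _).le⟩

/-- data processing inequality on arbitrary alphabets: if `X ⊸ Y ⊸ Z`,
then `I(X;Y) ≥ I(X;Z)`. -/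
theorem data_processing_inequality
    {Ω 𝒳 𝒴 𝒵 : Type*} [MeasurableSpace Ω] [MeasurableSpace 𝒳] [MeasurableSpace 𝒴]
    [MeasurableSpace 𝒵] (μ : Measure Ω) [IsProbabilityMeasure μ]
    (X : Ω → 𝒳) (Y : Ω → 𝒴) (Z : Ω → 𝒵)
    (hX : Measurable X) (hY : Measurable Y) (hZ : Measurable Z)
    (hMarkov : Markov μ X Y Z) :
    miGen μ X Z ≤ miGen μ X Y := by
  refine iSup_le fun k => iSup_le fun l => iSup_le fun f => iSup_le fun g =>
    iSup_le fun hf => iSup_le fun hg => ?_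
  have hm := hY.comap_le
  have hS : ∀ i, MeasurableSet ((f ∘ X) ⁻¹' {i}) := fun i =>
    (hf.comp hX) (measurableSet_singleton i)
  have hS' : ∀ j, MeasurableSet ((g ∘ Z) ⁻¹' {j}) := fun j =>
    (hg.comp hZ) (measurableSet_singleton j)
  have hfac : ∀ i, ∃ p : 𝒴 → ℝ, Measurable p ∧
      μ[ind ((f ∘ X) ⁻¹' {i}) | MeasurableSpace.comap Y inferInstance] = p ∘ Y := fun i =>
    stronglyMeasurable_condExp.measurable.exists_eq_measurable_comp
  choose p hp hpY using hfac
  let h : ∀ n : ℕ, 𝒴 → (Fin (k + 1) → Fin (n + 2)) := fun n y i => gridIndex n (p i y)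
  have hh : ∀ n, Measurable (h n) := fun n =>
    measurable_pi_lambda _ fun i => (measurable_gridIndex n).comp (hp i)
  have hT : ∀ n t, MeasurableSet ((h n ∘ Y) ⁻¹' {t}) := fun n t =>
    ((hh n).comp hY) (measurableSet_singleton t)
  let P : ℕ → Fin (k + 1) → Fin (l + 1) → ℝ := fun n i j =>
    ∑ t, μ.real ((f ∘ X) ⁻¹' {i} ∩ (h n ∘ Y) ⁻¹' {t}) *
      μ.real ((g ∘ Z) ⁻¹' {j} ∩ (h n ∘ Y) ⁻¹' {t}) / μ.real ((h n ∘ Y) ⁻¹' {t})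
  have hP : ∀ i j, Filter.Tendsto (fun n => P n i j) Filter.atTop
      (nhds (μ.real ((f ∘ X) ⁻¹' {i} ∩ (g ∘ Z) ⁻¹' {j}))) := by
    intro i j
    refine tendsto_iff_dist_tendsto_zero.2 (squeeze_zero (fun _ => dist_nonneg) (fun n => ?_)
      tendsto_one_div_add_atTop_nhds_zero_nat)
    rw [dist_comm, Real.dist_eq]
    refine abs_measureReal_inter_sub_le hm (hS i) (hS' j)
      (hMarkov _ _ (hf (measurableSet_singleton i)) (hg (measurableSet_singleton j)))
      (fun t => ⟨h n ⁻¹' {t}, hh n (measurableSet_singleton t), rfl⟩)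
      (c := fun t => (t i : ℕ) / (n + 1 : ℝ)) (by positivity) ?_
    filter_upwards [condExp_ind_mem_Icc (μ := μ) hm (hS i)] with ω hω
    rw [hpY i] at hω ⊢
    exact mem_Icc_gridIndex n hω
  have hle : ∀ n, ENNReal.ofReal (∑ i, negMulLog (μ.real ((f ∘ X) ⁻¹' {i})) +
      (∑ j, negMulLog (μ.real ((g ∘ Z) ⁻¹' {j})) - ∑ i, ∑ j, negMulLog (P n i j))) ≤
      miGen μ X Y := by
    intro n
    refine le_trans (ENNReal.ofReal_le_ofReal ?_)
      (ofReal_miFin_le_miGen_s9 X Y hf fun t => hh n (measurableSet_singleton t))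
    rw [miFin_eq]
    have hV : ∀ j, μ.real ((g ∘ Z) ⁻¹' {j}) =
        ∑ t, μ.real ((g ∘ Z) ⁻¹' {j} ∩ (h n ∘ Y) ⁻¹' {t}) := fun j =>
      (sum_measureReal_inter_preimage_singleton _ (hT n)).symm
    simp_rw [hV]
    refine add_le_add le_rfl (sum_negMulLog_sub_le
      (fun i t => μ.real ((f ∘ X) ⁻¹' {i} ∩ (h n ∘ Y) ⁻¹' {t}))
      (fun t j => μ.real ((g ∘ Z) ⁻¹' {j} ∩ (h n ∘ Y) ⁻¹' {t}))
      (fun t => μ.real ((h n ∘ Y) ⁻¹' {t}))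
      (fun _ _ => measureReal_nonneg) (fun _ _ => measureReal_nonneg) (fun t => ?_) (fun t => ?_))
    · simp_rw [Set.inter_comm _ ((h n ∘ Y) ⁻¹' {t})]
      exact sum_measureReal_inter_preimage_singleton _ hS
    · simp_rw [Set.inter_comm _ ((h n ∘ Y) ⁻¹' {t})]
      exact sum_measureReal_inter_preimage_singleton _ hS'
  rw [miFin_eq]
  have hlim : Filter.Tendsto (fun n => ∑ i, ∑ j, negMulLog (P n i j)) Filter.atTop
      (nhds (∑ i, ∑ j, negMulLog (μ.real ((f ∘ X) ⁻¹' {i} ∩ (g ∘ Z) ⁻¹' {j})))) :=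
    tendsto_finsetSum _ fun i _ => tendsto_finsetSum _ fun j _ =>
      (continuous_negMulLog.tendsto _).comp (hP i j)
  exact le_of_tendsto
    (ENNReal.tendsto_ofReal (tendsto_const_nhds.add (tendsto_const_nhds.sub hlim)))
    (Filter.Eventually.of_forall hle)

end IB
end
end

section
/- In the product construction below, the Markov chains Y ⊸ X̂ ⊸ Ũ and Y ⊸ X ⊸ Ũ hold, i.e., I(Y;Ũ|X̂) = 0 and I(Y;Ũ|X) = 0. -/
open MeasureTheory Real
open scoped ENNReal

noncomputable section

namespace IB

/-- `κ` is a regular conditional distribution of the finite-valued random variable `U` given the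
random variable `X`: for each `ω`, `κ ω` is a probability vector on `𝒰`; for each `u`, the map
`ω ↦ κ ω u` is `σ(X)`-measurable and agrees `μ`-a.e. with the conditional probability
`P(U = u | σ(X))`. -/
def IsRCD {Ω 𝒳 𝒰 : Type*} [MeasurableSpace Ω] [MeasurableSpace 𝒳] [Fintype 𝒰]
    (μ : Measure Ω) (X : Ω → 𝒳) (U : Ω → 𝒰) (κ : Ω → 𝒰 → ℝ) : Prop :=
  (∀ ω u, 0 ≤ κ ω u) ∧ (∀ ω, ∑ u : 𝒰, κ ω u = 1) ∧
  (∀ u, @Measurable Ω ℝ (MeasurableSpace.comap X inferInstance) _ fun ω => κ ω u) ∧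
  (∀ u, (fun ω => κ ω u) =ᵐ[μ]
    μ[ind (U ⁻¹' {u}) | MeasurableSpace.comap X inferInstance])

/-- The integral of the Kullback–Leibler divergence between the conditional joint distribution
of two finite-valued random variables given the σ-algebra `m` and the product of the
conditional marginals (expressed via conditional expectations of indicators). -/
noncomputable def condKL {Ω α β : Type*} [MeasurableSpace Ω] [Fintype α] [Fintype β]
    (μ : Measure Ω) (m : MeasurableSpace Ω) (A : Ω → α) (B : Ω → β) : ℝ :=
  ∫ ω, ∑ a : α, ∑ b : β,
    (μ[ind (A ⁻¹' {a} ∩ B ⁻¹' {b}) | m]) ω *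
      Real.log ((μ[ind (A ⁻¹' {a} ∩ B ⁻¹' {b}) | m]) ω /
        ((μ[ind (A ⁻¹' {a}) | m]) ω * (μ[ind (B ⁻¹' {b}) | m]) ω)) ∂μ

/-- Conditional mutual information `I(A;B|C)` of random variables with arbitrary alphabets. -/
noncomputable def condMIGen {Ω α β γ : Type*} [MeasurableSpace Ω] [MeasurableSpace α]
    [MeasurableSpace β] [MeasurableSpace γ]
    (μ : Measure Ω) (A : Ω → α) (B : Ω → β) (C : Ω → γ) : ℝ≥0∞ :=
  ⨆ (k : ℕ) (l : ℕ) (f : α → Fin (k + 1)) (g : β → Fin (l + 1))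
    (_ : Measurable f) (_ : Measurable g),
      ENNReal.ofReal (condKL μ (MeasurableSpace.comap C inferInstance) (f ∘ A) (g ∘ B))

theorem ind_inter {Ω : Type*} (s t : Set Ω) : ind (s ∩ t) = ind s * ind t :=
  Set.inter_indicator_one

theorem integrable_ind_s12 {Ω : Type*} {_ : MeasurableSpace Ω} {μ : Measure Ω} [IsFiniteMeasure μ]
    {s : Set Ω} (hs : MeasurableSet s) : Integrable (ind s) μ :=
  (integrable_const (1 : ℝ)).indicator hs

/-- Conditional mutual information vanishes along a Markov chain. -/
theorem Markov.condMIGen_eq_zero {Ω α β γ : Type*} [MeasurableSpace Ω] [MeasurableSpace α]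
    [MeasurableSpace β] [MeasurableSpace γ] {μ : Measure Ω} {A : Ω → α} {B : Ω → β} {C : Ω → γ}
    (h : Markov μ A C B) : condMIGen μ A B C = 0 := by
  simp only [condMIGen, ENNReal.iSup_eq_zero]
  intro k l f g hf hg
  rw [ENNReal.ofReal_eq_zero, condKL]
  refine (integral_eq_zero_of_ae ?_).le
  have hfg : ∀ᵐ ω ∂μ, ∀ (a : Fin (k + 1)) (b : Fin (l + 1)),
      (μ[ind ((f ∘ A) ⁻¹' {a} ∩ (g ∘ B) ⁻¹' {b}) | MeasurableSpace.comap C inferInstance]) ω =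
        (μ[ind ((f ∘ A) ⁻¹' {a}) | MeasurableSpace.comap C inferInstance]) ω *
          (μ[ind ((g ∘ B) ⁻¹' {b}) | MeasurableSpace.comap C inferInstance]) ω := by
    simp only [ae_all_iff]
    exact fun a b ↦ h _ _ (hf (measurableSet_singleton a)) (hg (measurableSet_singleton b))
  filter_upwards [hfg] with ω hω
  refine Finset.sum_eq_zero fun a _ ↦ Finset.sum_eq_zero fun b _ ↦ ?_
  rw [hω a b]
  rcases eq_or_ne ((μ[ind ((f ∘ A) ⁻¹' {a}) | MeasurableSpace.comap C inferInstance]) ω *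
    (μ[ind ((g ∘ B) ⁻¹' {b}) | MeasurableSpace.comap C inferInstance]) ω) 0 with h0 | h0
  · rw [h0, zero_mul]
  · rw [div_self h0, Real.log_one, mul_zero]

section Selection

variable {α 𝒰 ι : Type*} [MeasurableSpace α] [MeasurableSpace 𝒰] [Fintype ι] [MeasurableSpace ι]
  [DiscreteMeasurableSpace ι] {μ : Measure α} [IsProbabilityMeasure μ]
  {ν : ι → Measure 𝒰} [∀ i, IsProbabilityMeasure (ν i)] {S : α → ι}

theorem measurable_selection (hS : Measurable S) :
    Measurable fun ω : α × (ι → 𝒰) ↦ ω.2 (S ω.1) :=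
  (measurable_from_prod_countable_right (f := fun p : ι × (ι → 𝒰) ↦ p.2 p.1)
    measurable_pi_apply).comp ((hS.comp measurable_fst).prodMk measurable_snd)

/-- Given the first coordinate `x`, the selected coordinate is distributed as `ν (S x)`. -/
theorem condExp_fst_selection (hS : Measurable S) {F : Set 𝒰} (hF : MeasurableSet F) :
    (μ.prod (Measure.pi ν))[ind ((fun ω : α × (ι → 𝒰) ↦ ω.2 (S ω.1)) ⁻¹' F) |
        MeasurableSpace.comap Prod.fst inferInstance]
      =ᵐ[μ.prod (Measure.pi ν)] fun ω ↦ (ν (S ω.1)).real F := by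
  have hg : Measurable fun x ↦ (ν (S x)).real F :=
    (Measurable.of_discrete (f := fun i ↦ (ν i).real F)).comp hS
  have hgint : Integrable (fun ω : α × (ι → 𝒰) ↦ (ν (S ω.1)).real F)
      (μ.prod (Measure.pi ν)) :=
    .of_bound (hg.comp measurable_fst).aestronglyMeasurable 1
      (.of_forall fun ω ↦ by simp [abs_of_nonneg])
  have hind := integrable_ind_s12 (μ := μ.prod (Measure.pi ν)) (measurable_selection hS hF)
  refine (ae_eq_condExp_of_forall_setIntegral_eq measurable_fst.comap_le hind
    (fun _ _ _ ↦ hgint.integrableOn) ?_ ?_).symm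
  · rintro _ ⟨B, hB, rfl⟩ -
    have hrestr : (μ.prod (Measure.pi ν)).restrict (Prod.fst ⁻¹' B) =
        (μ.restrict B).prod (Measure.pi ν) := by
      rw [← Set.prod_univ, ← Measure.prod_restrict, Measure.restrict_univ]
    have hind' := hind.integrableOn (s := Prod.fst ⁻¹' B)
    have hgint' := hgint.integrableOn (s := Prod.fst ⁻¹' B)
    rw [IntegrableOn, hrestr] at hind' hgint'
    rw [hrestr, integral_prod _ hgint', integral_prod _ hind']
    congr with x
    have hx : (fun y : ι → 𝒰 ↦
        ind ((fun ω : α × (ι → 𝒰) ↦ ω.2 (S ω.1)) ⁻¹' F) (x, y)) =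
        Set.indicator (Function.eval (S x) ⁻¹' F) (fun _ ↦ (1 : ℝ)) := rfl
    rw [hx, integral_indicator_const _ (measurable_pi_apply _ hF)]
    simp [(measurePreserving_eval ν (S x)).measureReal_preimage hF.nullMeasurableSet]
  · exact (hg.comp (comap_measurable Prod.fst)).aestronglyMeasurable

/-- Any `A` depending on the first coordinate only is conditionally independent of the selected
coordinate given any `Z` that determines the selection. -/
theorem markov_selection {β γ : Type*} [MeasurableSpace β] [MeasurableSpace γ]
    {A : α → β} {Z : α → γ} (hA : Measurable A) (hZ : Measurable Z)
    (hS : Measurable[MeasurableSpace.comap Z inferInstance] S) :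
    Markov (μ.prod (Measure.pi ν)) (fun ω ↦ A ω.1) (fun ω ↦ Z ω.1) (fun ω ↦ ω.2 (S ω.1)) := by
  intro E F hE hF
  set T : α × (ι → 𝒰) → 𝒰 := fun ω ↦ ω.2 (S ω.1)
  set V : α × (ι → 𝒰) → β := fun ω ↦ A ω.1
  set g : α × (ι → 𝒰) → ℝ := fun ω ↦ (ν (S ω.1)).real F
  set P := μ.prod (Measure.pi ν)
  have hS' : Measurable S := hS.mono hZ.comap_le le_rfl
  have hTF : MeasurableSet (T ⁻¹' F) := measurable_selection hS' hF
  set m := MeasurableSpace.comap (fun ω : α × (ι → 𝒰) ↦ Z ω.1) inferInstance with hm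
  have hm_le : m ≤ MeasurableSpace.comap Prod.fst inferInstance := by
    rw [hm, ← Function.comp_def, ← MeasurableSpace.comap_comp]
    exact MeasurableSpace.comap_mono hZ.comap_le
  have hgm : StronglyMeasurable[m] g := by
    have hSm : Measurable[m] fun ω : α × (ι → 𝒰) ↦ S ω.1 := by
      rw [hm, ← Function.comp_def, ← MeasurableSpace.comap_comp]
      exact hS.comp (comap_measurable Prod.fst)
    exact (Measurable.comp (Measurable.of_discrete (f := fun i ↦ (ν i).real F))
      hSm).stronglyMeasurable
  have hV : Measurable[MeasurableSpace.comap Prod.fst inferInstance] V :=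
    hA.comp (comap_measurable Prod.fst)
  have hgint : Integrable g P :=
    .of_bound (hgm.mono (hm_le.trans measurable_fst.comap_le)).aestronglyMeasurable 1
      (.of_forall fun ω ↦ by simp [g, abs_of_nonneg])
  have key : ∀ B : Set (α × (ι → 𝒰)),
      MeasurableSet[MeasurableSpace.comap Prod.fst inferInstance] B →
        P[ind (B ∩ T ⁻¹' F) | m] =ᵐ[P] P[ind B | m] * g := by
    intro B hB
    have hB' : MeasurableSet[Prod.instMeasurableSpace] B := measurable_fst.comap_le _ hB
    have hBind : StronglyMeasurable[MeasurableSpace.comap Prod.fst inferInstance] (ind B) :=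
      stronglyMeasurable_const.indicator hB
    have hint : Integrable (ind B * ind (T ⁻¹' F)) P := by
      rw [← ind_inter]; exact integrable_ind_s12 (hB'.inter hTF)
    have hBg : Integrable (ind B * g) P := by
      have : ind B * g = B.indicator g := by
        ext ω; by_cases h : ω ∈ B <;> simp [ind, h]
      rw [this]
      exact hgint.indicator hB'
    rw [ind_inter]
    calc P[ind B * ind (T ⁻¹' F) | m]
        =ᵐ[P] P[P[ind B * ind (T ⁻¹' F) | MeasurableSpace.comap Prod.fst inferInstance] | m] :=
          (condExp_condExp_of_le hm_le measurable_fst.comap_le).symm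
      _ =ᵐ[P] P[ind B * g | m] := by
          refine condExp_congr_ae ?_
          refine (condExp_mul_of_stronglyMeasurable_left hBind hint
            (integrable_ind_s12 hTF)).trans ?_
          exact (Filter.EventuallyEq.refl _ _).mul (condExp_fst_selection hS' hF)
      _ =ᵐ[P] P[ind B | m] * g :=
          condExp_mul_of_stronglyMeasurable_right hgm hBg (integrable_ind_s12 hB')
  have huniv : P[ind (T ⁻¹' F) | m] =ᵐ[P] g := by
    have h := key Set.univ MeasurableSet.univ
    have h1 : (ind Set.univ : α × (ι → 𝒰) → ℝ) = fun _ ↦ 1 := by simp [ind]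
    rw [Set.univ_inter, h1, condExp_const (hm_le.trans measurable_fst.comap_le)] at h
    filter_upwards [h] with ω hω
    simpa using hω
  filter_upwards [key (V ⁻¹' E) (hV hE), huniv] with ω h1 h2
  rw [h1, h2, Pi.mul_apply]

end Selection

/-- in the product construction, the Markov chains `Y ⊸ X̂ ⊸ Ũ` and `Y ⊸ X ⊸ Ũ` hold, i.e. `I(Y;Ũ|X̂) = 0` and `I(Y;Ũ|X) = 0`. -/
theorem markov_of_product_construction
    {𝒴 𝒳 𝒰 ι : Type*}
    [Fintype 𝒴] [MeasurableSpace 𝒴] [MeasurableSingletonClass 𝒴]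
    [MeasurableSpace 𝒳]
    [Fintype 𝒰] [MeasurableSpace 𝒰] [MeasurableSingletonClass 𝒰]
    [Fintype ι] [MeasurableSpace ι] [MeasurableSingletonClass ι]
    (μYXU : Measure (𝒴 × 𝒳 × 𝒰)) [IsProbabilityMeasure μYXU]
    (κ : 𝒴 × 𝒳 × 𝒰 → 𝒰 → ℝ)
    (hκ : IsRCD μYXU (fun p => p.2.1) (fun p => p.2.2) κ)
    (P : ι → Set (𝒰 → ℝ)) (hP : ∀ i, MeasurableSet (P i))
    (hPdisj : Pairwise fun i j => Disjoint (P i) (P j))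
    (νvec : ι → 𝒰 → ℝ) (hνmem : ∀ i, νvec i ∈ P i)
    (ν : ι → Measure 𝒰) (hνprob : ∀ i, IsProbabilityMeasure (ν i))
    (hν : ∀ i u, ν i {u} = ENNReal.ofReal (νvec i u))
    (Xhat : 𝒴 × 𝒳 × 𝒰 → ι) (hXhat : ∀ p i, Xhat p = i ↔ κ p ∈ P i) :
    Markov (μYXU.prod (Measure.pi ν))
        (fun ω => ω.1.1) (fun ω => Xhat ω.1) (fun ω => ω.2 (Xhat ω.1)) ∧
    Markov (μYXU.prod (Measure.pi ν))
        (fun ω => ω.1.1) (fun ω => ω.1.2.1) (fun ω => ω.2 (Xhat ω.1)) ∧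
    condMIGen (μYXU.prod (Measure.pi ν))
        (fun ω => ω.1.1) (fun ω => ω.2 (Xhat ω.1)) (fun ω => Xhat ω.1) = 0 ∧
    condMIGen (μYXU.prod (Measure.pi ν))
        (fun ω => ω.1.1) (fun ω => ω.2 (Xhat ω.1)) (fun ω => ω.1.2.1) = 0 := by
  have hXX : Measurable[MeasurableSpace.comap (fun p : 𝒴 × 𝒳 × 𝒰 ↦ p.2.1) inferInstance] Xhat :=
    @measurable_to_countable' _ _ _ _ (_) _ fun i ↦ by
      have hpre : Xhat ⁻¹' {i} = κ ⁻¹' P i := by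
        ext p
        exact hXhat p i
      rw [hpre]
      exact (@measurable_pi_iff _ _ _ (_) _ _).2 hκ.2.2.1 (hP i)
  have hX : Measurable fun p : 𝒴 × 𝒳 × 𝒰 ↦ p.2.1 := measurable_fst.comp measurable_snd
  have hM₁ := markov_selection (μ := μYXU) (ν := ν) measurable_fst
    (hXX.mono hX.comap_le le_rfl) (comap_measurable Xhat)
  have hM₂ := markov_selection (μ := μYXU) (ν := ν) measurable_fst hX hXX
  exact ⟨hM₁, hM₂, hM₁.condMIGen_eq_zero, hM₂.condMIGen_eq_zero⟩

end IB
end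
end

section
/- Approximation of a finite-valued function of an i.i.d. vector by a per-letter quantizer: let (Y,X) have values in 𝒴×𝒳 with 𝒴 finite and 𝒳 arbitrary, let (Y^n,X^n) be n i.i.d. copies, and let f : 𝒳^n → M be measurable with M finite. Then for every δ > 0 there exist a finite set I, a measurable function q : 𝒳 → I, and a function g : I^n → M such that for all 𝐲 ∈ 𝒴^n and m ∈ M, |μ(Y^n = 𝐲, f(X^n) = m) − μ(Y^n = 𝐲, g(q^n(X^n)) = m)| ≤ |M|²·δ, where q^n denotes the coordinatewise application of q. -/
open MeasureTheory Real
open scoped ENNReal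

noncomputable section

namespace IB

/-- A set of vectors is letterwise quantizable if membership depends only on the image of the
vector under the coordinatewise application of some measurable finite-valued quantizer. -/
def LetterwiseQuantizable {ι 𝒳 : Type*} [MeasurableSpace 𝒳] (s : Set (ι → 𝒳)) : Prop :=
  ∃ (k : ℕ) (q : 𝒳 → Fin (k + 1)), Measurable q ∧
    ∃ t : Set (ι → Fin (k + 1)), s = (fun x i => q (x i)) ⁻¹' t

/-- Finitely many measurable finite-valued quantizers have a common measurable refinement. -/
theorem exists_common_refinement {J 𝒳 : Type*} [Finite J] [MeasurableSpace 𝒳] (k : J → ℕ)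
    (q : ∀ j, 𝒳 → Fin (k j + 1)) (hq : ∀ j, Measurable (q j)) :
    ∃ (l : ℕ) (p : 𝒳 → Fin (l + 1)), Measurable p ∧
      ∃ r : ∀ j, Fin (l + 1) → Fin (k j + 1), ∀ j x, q j x = r j (p x) := by
  classical
  have := Fintype.ofFinite J
  obtain ⟨l, hl⟩ := Nat.exists_eq_succ_of_ne_zero
    (Fintype.card_ne_zero (α := ∀ j, Fin (k j + 1)))
  let e := Fintype.equivFinOfCardEq hl
  refine ⟨l, fun x => e fun j => q j x, ?_, fun j z => e.symm z j, fun j x => by simp⟩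
  exact (measurable_of_countable e).comp (measurable_pi_lambda _ hq)

/-- Finitely many letterwise quantizable sets share a common quantizer. -/
theorem exists_common_quantizer {J ι 𝒳 : Type*} [Finite J] [MeasurableSpace 𝒳]
    {s : J → Set (ι → 𝒳)} (hs : ∀ j, LetterwiseQuantizable (s j)) :
    ∃ (k : ℕ) (q : 𝒳 → Fin (k + 1)), Measurable q ∧
      ∃ t : J → Set (ι → Fin (k + 1)), ∀ j, s j = (fun x i => q (x i)) ⁻¹' t j := by
  choose k q hq t ht using hs
  obtain ⟨l, p, hp, r, hr⟩ := exists_common_refinement k q hq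
  refine ⟨l, p, hp, fun j => (fun z i => r j (z i)) ⁻¹' t j, fun j => ?_⟩
  rw [ht j]
  ext x
  simp [hr]

theorem isSetRing_letterwiseQuantizable {ι 𝒳 : Type*} [MeasurableSpace 𝒳] :
    IsSetRing {s : Set (ι → 𝒳) | LetterwiseQuantizable s} where
  empty_mem := ⟨0, fun _ => 0, measurable_const, ∅, rfl⟩
  union_mem s t hs ht := by
    obtain ⟨k, q, hq, u, hu⟩ := exists_common_quantizer (s := fun b : Bool => cond b s t)
      (Bool.rec ht hs)
    have hs' : s = _ := hu true
    have ht' : t = _ := hu false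
    exact ⟨k, q, hq, u true ∪ u false, by rw [Set.preimage_union, ← hs', ← ht']⟩
  sdiff_mem s t hs ht := by
    obtain ⟨k, q, hq, u, hu⟩ := exists_common_quantizer (s := fun b : Bool => cond b s t)
      (Bool.rec ht hs)
    have hs' : s = _ := hu true
    have ht' : t = _ := hu false
    exact ⟨k, q, hq, u true \ u false, by rw [Set.preimage_sdiff, ← hs', ← ht']⟩

theorem generateFrom_letterwiseQuantizable {ι 𝒳 : Type*} [Finite ι] [MeasurableSpace 𝒳] :
    (MeasurableSpace.pi : MeasurableSpace (ι → 𝒳)) =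
      MeasurableSpace.generateFrom {s | LetterwiseQuantizable s} := by
  classical
  apply le_antisymm
  · refine iSup_le fun i => ?_
    rintro _ ⟨s, hs, rfl⟩
    refine MeasurableSpace.measurableSet_generateFrom
      ⟨1, fun x => if x ∈ s then 1 else 0, Measurable.ite hs measurable_const measurable_const,
        {z | z i = 1}, ?_⟩
    ext x
    by_cases h : x i ∈ s <;> simp [h]
  · refine MeasurableSpace.generateFrom_le ?_
    rintro _ ⟨k, q, hq, t, rfl⟩
    exact (measurable_pi_lambda _ fun i => hq.comp (measurable_pi_apply i)) t.toFinite.measurableSet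

/-- A finite-valued measurable function of a vector agrees, off a set of small measure, with a
function of a letterwise quantization of the vector. -/
theorem exists_letterwise_quantizer_measure_ne_le {ι 𝒳 M : Type*} [Finite ι] [MeasurableSpace 𝒳]
    [Fintype M] [Nonempty M] [MeasurableSpace M] [MeasurableSingletonClass M]
    (ν : Measure (ι → 𝒳)) [IsFiniteMeasure ν] {f : (ι → 𝒳) → M} (hf : Measurable f)
    {ε : ℝ≥0∞} (hε : 0 < ε) :
    ∃ (k : ℕ) (q : 𝒳 → Fin (k + 1)), Measurable q ∧
      ∃ g : (ι → Fin (k + 1)) → M,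
        ν {x | f x ≠ g fun i => q (x i)} ≤ Fintype.card M * ε := by
  classical
  have happrox (m : M) := exists_measure_symmDiff_lt_of_generateFrom_isSetRing (μ := ν)
    isSetRing_letterwiseQuantizable
    ⟨{Set.univ}, Set.countable_singleton _,
      Set.singleton_subset_iff.2 ⟨0, fun _ => 0, measurable_const, Set.univ, rfl⟩, by simp⟩
    generateFrom_letterwiseQuantizable (hf (measurableSet_singleton m)) hε
  choose s hs hsε using happrox
  obtain ⟨k, q, hq, t, ht⟩ := exists_common_quantizer hs
  let g : (ι → Fin (k + 1)) → M := fun z =>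
    if h : ∃ m, z ∈ t m then h.choose else Classical.arbitrary M
  refine ⟨k, q, hq, g, ?_⟩
  have hsub : {x | f x ≠ g fun i => q (x i)} ⊆ ⋃ m, symmDiff (s m) (f ⁻¹' {m}) := by
    intro x hx
    by_contra hcon
    have hmem (m : M) : (fun i => q (x i)) ∈ t m ↔ f x = m := by
      have h : x ∉ symmDiff (s m) (f ⁻¹' {m}) := fun h => hcon (Set.mem_iUnion.2 ⟨m, h⟩)
      rw [ht m, Set.mem_symmDiff] at h
      simp only [Set.mem_preimage, Set.mem_singleton_iff] at h
      tauto
    have hex : ∃ m, (fun i => q (x i)) ∈ t m := ⟨f x, (hmem _).2 rfl⟩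
    apply hx
    simp only [g, dif_pos hex]
    exact (hmem _).1 hex.choose_spec
  calc ν {x | f x ≠ g fun i => q (x i)}
      ≤ ν (⋃ m, symmDiff (s m) (f ⁻¹' {m})) := measure_mono hsub
    _ ≤ ∑ m, ν (symmDiff (s m) (f ⁻¹' {m})) := measure_iUnion_fintype_le _ _
    _ ≤ ∑ _m : M, ε := Finset.sum_le_sum fun m _ => (hsε m).le
    _ = Fintype.card M * ε := by simp

/-- any finite-valued measurable function `f` of an i.i.d. vector `Xⁿ` can be
approximated in joint distribution with `Yⁿ` by a function `g` of a per-letter quantization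
`qⁿ(Xⁿ)`, up to error `|M|² δ`. -/
theorem per_letter_approximation
    {𝒴 𝒳 : Type*} [Fintype 𝒴] [MeasurableSpace 𝒴] [MeasurableSingletonClass 𝒴]
    [MeasurableSpace 𝒳]
    (μYX : Measure (𝒴 × 𝒳)) [IsProbabilityMeasure μYX]
    (n : ℕ) (hn : 0 < n) {M : Type*} [Fintype M] [MeasurableSpace M]
    [MeasurableSingletonClass M] (f : (Fin n → 𝒳) → M) (hf : Measurable f)
    (δ : ℝ) (hδ : 0 < δ) :
    ∃ (k : ℕ) (q : 𝒳 → Fin (k + 1)), Measurable q ∧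
      ∃ g : (Fin n → Fin (k + 1)) → M,
        ∀ (y : Fin n → 𝒴) (m : M),
          |((Measure.pi fun _ : Fin n => μYX)
              {ω | (fun i => (ω i).1) = y ∧ f (fun i => (ω i).2) = m}).toReal -
           ((Measure.pi fun _ : Fin n => μYX)
              {ω | (fun i => (ω i).1) = y ∧ g (fun i => q ((ω i).2)) = m}).toReal| ≤
            (Fintype.card M : ℝ) ^ 2 * δ := by
  have hne : Nonempty 𝒳 := (nonempty_of_isProbabilityMeasure μYX).map Prod.snd
  have hM : Nonempty M := hne.map fun x => f fun _ => x
  let P := Measure.pi fun _ : Fin n => μYX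
  let X : (Fin n → 𝒴 × 𝒳) → Fin n → 𝒳 := fun ω i => (ω i).2
  have hX : Measurable X := by fun_prop
  obtain ⟨k, q, hq, g, hg⟩ := exists_letterwise_quantizer_measure_ne_le (P.map X) hf
    (ENNReal.ofReal_pos.2 hδ)
  refine ⟨k, q, hq, g, fun y m => ?_⟩
  have hbad : P.real {ω | f (X ω) ≠ g fun i => q (X ω i)} ≤ Fintype.card M * δ := by
    refine ENNReal.toReal_le_of_le_ofReal (by positivity)
      ((Measure.le_map_apply hX.aemeasurable _).trans (hg.trans_eq ?_))
    rw [ENNReal.ofReal_mul (by positivity), ENNReal.ofReal_natCast]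
  have hle {a b : (Fin n → 𝒳) → M}
      (h : P.real {ω | a (X ω) ≠ b (X ω)} ≤ Fintype.card M * δ) :
      P.real {ω | (fun i => (ω i).1) = y ∧ a (X ω) = m} ≤
        P.real {ω | (fun i => (ω i).1) = y ∧ b (X ω) = m} + Fintype.card M * δ := by
    refine (measureReal_mono ?_).trans ((measureReal_union_le _ _).trans (add_le_add_right h _))
    rintro ω ⟨hy, ha⟩
    by_cases hab : a (X ω) = b (X ω)
    · exact Or.inl ⟨hy, hab ▸ ha⟩
    · exact Or.inr hab
  have hcard : (Fintype.card M : ℝ) * δ ≤ (Fintype.card M : ℝ) ^ 2 * δ := by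
    gcongr
    exact le_self_pow₀ (mod_cast Fintype.card_pos) two_ne_zero
  have h₁ := hle (a := f) (b := fun x => g fun i => q (x i)) hbad
  have h₂ := hle (a := fun x => g fun i => q (x i)) (b := f) (by simpa only [ne_comm] using hbad)
  refine le_trans ?_ hcard
  exact abs_sub_le_iff.2 ⟨sub_le_iff_le_add'.2 h₁, sub_le_iff_le_add'.2 h₂⟩

end IB
end
end
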